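/- arXiv:1306.0747 — 6 statements merged into one kernel-verified Lean document; each statement's English description precedes it below -/
import Mathlib

section
/- Let G be a finite group and π a set of primes such that d_π(G) > 5/8. Then d_π(G) = 1 or d_π(G) = 2/3. -/
open scoped Classical Pointwise

/-- A `π`-element: every prime divisor of its order lies in `π`. -/
def IsPiElement {G : Type*} [Group G] (π : Set ℕ) (x : G) : Prop :=
  ∀ q : ℕ, q.Prime → q ∣ orderOf x → q ∈ π

/-- `kPi π G` is the number of conjugacy classes of `π`-elements of `G`. -/
noncomputable def kPi (π : Set ℕ) (G : Type*) [Group G] : ℕ :=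
  Nat.card {c : ConjClasses G | ∃ x : G, ConjClasses.mk x = c ∧ IsPiElement π x}

/-- The `π`-part of a natural number: the largest divisor all of whose prime
divisors lie in `π`. -/
noncomputable def piPart (π : Set ℕ) (n : ℕ) : ℕ :=
  n.factorization.prod fun p k => if p ∈ π then p ^ k else 1

/-- `dPi π G = kPi π G / |G|_π`. -/
noncomputable def dPi (π : Set ℕ) (G : Type*) [Group G] : ℚ :=
  (kPi π G : ℚ) / (piPart π (Nat.card G) : ℚ)

theorem piPart_ne_zero (σ : Set ℕ) (n : ℕ) : piPart σ n ≠ 0 := by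
  unfold piPart
  rw [Finsupp.prod, Finset.prod_ne_zero_iff]
  intro p hp
  have := Nat.prime_of_mem_primeFactors (by simpa using hp)
  split_ifs
  · exact pow_ne_zero _ this.ne_zero
  · exact one_ne_zero

theorem piPart_factorization (σ : Set ℕ) (n : ℕ) (q : ℕ) :
    (piPart σ n).factorization q = if q ∈ σ then n.factorization q else 0 := by
  unfold piPart
  rw [Finsupp.prod, Nat.factorization_prod_apply]
  · have : ∀ p ∈ n.factorization.support,
        (if p ∈ σ then p ^ n.factorization p else 1).factorization q
          = if p = q then (if q ∈ σ then n.factorization q else 0) else 0 := by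
      intro p hp
      have hpp : p.Prime := Nat.prime_of_mem_primeFactors (by simpa using hp)
      by_cases h : p = q
      · subst h
        simp only [↓reduceIte]
        split_ifs with h1
        · simp [hpp.factorization]
        · simp
      · split_ifs with h1
        · simp [hpp.factorization, h]
        · simp
    rw [Finset.sum_congr rfl this, Finset.sum_ite_eq']
    split_ifs with h1 h2
    · rfl
    · rfl
    · exact (Finsupp.notMem_support_iff.mp h1).symm
    · rfl
  · intro p hp
    have := Nat.prime_of_mem_primeFactors (by simpa using hp : p ∈ n.primeFactors)
    split_ifs
    · exact pow_ne_zero _ this.ne_zero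
    · exact one_ne_zero

theorem piPart_dvd_piPart (σ : Set ℕ) {m n : ℕ} (hn : n ≠ 0) (h : m ∣ n) :
    piPart σ m ∣ piPart σ n := by
  have hm : m ≠ 0 := fun h0 => hn (by simpa [h0] using h)
  rw [← Nat.factorization_le_iff_dvd (piPart_ne_zero _ _) (piPart_ne_zero _ _)]
  intro q
  rw [piPart_factorization, piPart_factorization]
  split_ifs
  · exact (Nat.factorization_le_iff_dvd hm hn).mpr h q
  · exact le_rfl

theorem piPart_le (σ : Set ℕ) {m n : ℕ} (hn : n ≠ 0) (h : m ∣ n) :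
    piPart σ m ≤ piPart σ n :=
  Nat.le_of_dvd (Nat.pos_of_ne_zero (piPart_ne_zero _ _)) (piPart_dvd_piPart σ hn h)

theorem piPart_eq_self {σ : Set ℕ} {n : ℕ} (hn : n ≠ 0)
    (h : ∀ q : ℕ, q.Prime → q ∣ n → q ∈ σ) : piPart σ n = n := by
  apply Nat.eq_of_factorization_eq (piPart_ne_zero _ _) hn
  intro q
  rw [piPart_factorization]
  split_ifs with h1
  · rfl
  · by_contra h2
    have h3 : q ∈ n.primeFactors := by
      rw [← Nat.support_factorization, Finsupp.mem_support_iff]; exact fun h => h2 h.symm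
    exact h1 (h q (Nat.prime_of_mem_primeFactors h3) (Nat.dvd_of_mem_primeFactors h3))

theorem piPart_prime_mem {σ : Set ℕ} {n q : ℕ} (hq : q.Prime) (h : q ∣ piPart σ n) : q ∈ σ := by
  by_contra h1
  have := hq.factorization_pos_of_dvd (piPart_ne_zero σ n) h
  rw [piPart_factorization, if_neg h1] at this
  exact lt_irrefl _ this

theorem piPart_union {σ τ : Set ℕ} (hd : Disjoint σ τ) (n : ℕ) :
    piPart (σ ∪ τ) n = piPart σ n * piPart τ n := by
  apply Nat.eq_of_factorization_eq (piPart_ne_zero _ _)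
    (mul_ne_zero (piPart_ne_zero _ _) (piPart_ne_zero _ _))
  intro q
  rw [Nat.factorization_mul (piPart_ne_zero _ _) (piPart_ne_zero _ _), Finsupp.add_apply]
  simp only [piPart_factorization, Set.mem_union]
  by_cases h1 : q ∈ σ
  · have : q ∉ τ := Set.disjoint_left.mp hd h1
    simp [h1, this]
  · simp [h1]

theorem piPart_congr {σ τ : Set ℕ} {n : ℕ}
    (h : ∀ q : ℕ, q.Prime → q ∣ n → (q ∈ σ ↔ q ∈ τ)) : piPart σ n = piPart τ n := by
  apply Nat.eq_of_factorization_eq (piPart_ne_zero _ _) (piPart_ne_zero _ _)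
  intro q
  simp only [piPart_factorization]
  by_cases h2 : n.factorization q = 0
  · simp [h2]
  · have h3 : q ∈ n.primeFactors := by
      rw [← Nat.support_factorization, Finsupp.mem_support_iff]; exact h2
    simp only [h q (Nat.prime_of_mem_primeFactors h3) (Nat.dvd_of_mem_primeFactors h3)]

theorem piPart_mul_compl (σ : Set ℕ) {n : ℕ} (hn : n ≠ 0) :
    piPart σ n * piPart σᶜ n = n := by
  rw [← piPart_union disjoint_compl_right, Set.union_compl_self]
  exact piPart_eq_self hn (fun _ _ _ => Set.mem_univ _)

theorem piPart_dvd (σ : Set ℕ) {n : ℕ} (hn : n ≠ 0) : piPart σ n ∣ n :=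
  ⟨_, (piPart_mul_compl σ hn).symm⟩

theorem piPart_coprime (σ : Set ℕ) (m n : ℕ) : Nat.Coprime (piPart σ m) (piPart σᶜ n) := by
  apply Nat.Coprime.symm
  apply Nat.coprime_of_dvd
  intro q hq h1 h2
  exact piPart_prime_mem hq h1 (piPart_prime_mem hq h2)

theorem piPart_mul_left {σ : Set ℕ} {a b : ℕ} (ha : a ≠ 0) (hb : b ≠ 0)
    (h1 : ∀ q : ℕ, q.Prime → q ∣ a → q ∈ σ) (h2 : ∀ q : ℕ, q.Prime → q ∣ b → q ∉ σ) :
    piPart σ (a * b) = a := by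
  have h3 : piPart σ (a * b) = piPart σ a * piPart σ b := by
    apply Nat.eq_of_factorization_eq (piPart_ne_zero _ _)
      (mul_ne_zero (piPart_ne_zero _ _) (piPart_ne_zero _ _))
    intro q
    rw [Nat.factorization_mul (piPart_ne_zero _ _) (piPart_ne_zero _ _), Finsupp.add_apply]
    simp only [piPart_factorization, Nat.factorization_mul ha hb, Finsupp.add_apply]
    split_ifs <;> rfl
  have h4 : piPart σ b = 1 := by
    by_contra hne
    obtain ⟨q, hq, hd⟩ := Nat.exists_prime_and_dvd hne
    exact h2 q hq (hd.trans (piPart_dvd σ hb)) (piPart_prime_mem hq hd)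
  rw [h3, h4, mul_one, piPart_eq_self ha h1]

theorem piPart_singleton {p n : ℕ} (hp : p.Prime) : piPart {p} n = p ^ n.factorization p := by
  apply Nat.eq_of_factorization_eq (piPart_ne_zero _ _) (pow_ne_zero _ hp.ne_zero)
  intro q
  rw [piPart_factorization, hp.factorization_pow, Finsupp.single_apply]
  simp only [Set.mem_singleton_iff, eq_comm]
  split_ifs with h
  · rw [h]
  · rfl

theorem dvd_piPart {σ : Set ℕ} {m n : ℕ} (hn : n ≠ 0) (h : m ∣ n)
    (h1 : ∀ q : ℕ, q.Prime → q ∣ m → q ∈ σ) : m ∣ piPart σ n := by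
  have hm : m ≠ 0 := fun h0 => hn (by simpa [h0] using h)
  rw [← piPart_eq_self hm h1]
  exact piPart_dvd_piPart σ hn h

/-! ### π-elements -/

theorem IsPiElement.of_dvd {G H : Type*} [Group G] [Group H] {σ : Set ℕ} {x : G} {y : H}
    (hx : IsPiElement σ x) (h : orderOf y ∣ orderOf x) : IsPiElement σ y :=
  fun q hq hd => hx q hq (hd.trans h)

theorem IsPiElement.pow {G : Type*} [Group G] {σ : Set ℕ} {x : G}
    (hx : IsPiElement σ x) (n : ℕ) : IsPiElement σ (x ^ n) :=
  hx.of_dvd (orderOf_pow_dvd n)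

theorem IsPiElement.of_pow_eq_one {G : Type*} [Group G] {σ : Set ℕ} {x : G} {n : ℕ}
    (hn : ∀ q : ℕ, q.Prime → q ∣ n → q ∈ σ) (h : x ^ n = 1) : IsPiElement σ x :=
  fun q hq hd => hn q hq (hd.trans (orderOf_dvd_of_pow_eq_one h))

theorem isPiElement_conj_iff {G : Type*} [Group G] {σ : Set ℕ} {x y : G} (h : IsConj x y) :
    IsPiElement σ x ↔ IsPiElement σ y := by
  obtain ⟨c, rfl⟩ := isConj_iff.mp h
  have : orderOf (c * x * c⁻¹) = orderOf x := by
    rw [← MulAut.conj_apply]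
    exact orderOf_injective (MulAut.conj c).toMonoidHom (MulAut.conj c).injective x
  unfold IsPiElement
  rw [this]

theorem IsPiElement.mono {G : Type*} [Group G] {σ τ : Set ℕ} {x : G}
    (hx : IsPiElement σ x) (h : σ ⊆ τ) : IsPiElement τ x :=
  fun q hq hd => h (hx q hq hd)

theorem isPiElement_coe {G : Type*} [Group G] {H : Subgroup G} {σ : Set ℕ} {x : H} :
    IsPiElement σ (x : G) ↔ IsPiElement σ x := by
  unfold IsPiElement
  rw [Subgroup.orderOf_coe]

theorem IsPiElement.orderOf_dvd {G : Type*} [Group G] [Finite G] {σ : Set ℕ} {x : G}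
    (hx : IsPiElement σ x) : orderOf x ∣ piPart σ (Nat.card G) :=
  dvd_piPart Nat.card_pos.ne' (orderOf_dvd_natCard x) hx

/-- Exponents extracting the `σ`-part and the `σᶜ`-part of every element. -/
theorem exists_exponents (G : Type*) [Group G] [Finite G] (σ : Set ℕ) :
    ∃ e f : ℕ, ∀ x : G, (IsPiElement σ x → x ^ e = x ∧ x ^ f = 1) ∧
      (IsPiElement σᶜ x → x ^ e = 1 ∧ x ^ f = x) ∧
      IsPiElement σ (x ^ e) ∧ IsPiElement σᶜ (x ^ f) ∧ x ^ e * x ^ f = x := by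
  set a := piPart σ (Nat.card G) with ha
  set b := piPart σᶜ (Nat.card G) with hb
  have hab : Nat.Coprime a b := piPart_coprime _ _ _
  have hmul : a * b = Nat.card G := piPart_mul_compl σ Nat.card_pos.ne'
  obtain ⟨e, he1, he2⟩ := Nat.chineseRemainder hab 1 0
  obtain ⟨f, hf1, hf2⟩ := Nat.chineseRemainder hab 0 1
  have key : ∀ (x : G) (m k l : ℕ), orderOf x ∣ m → k ≡ l [MOD m] → x ^ k = x ^ l := by
    intro x m k l h1 h2
    exact pow_eq_pow_iff_modEq.mpr (h2.of_dvd h1)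
  refine ⟨e, f, fun x => ⟨fun hx => ⟨?_, ?_⟩, fun hx => ⟨?_, ?_⟩, ?_, ?_, ?_⟩⟩
  · simpa using key x a e 1 hx.orderOf_dvd he1
  · simpa using key x a f 0 hx.orderOf_dvd hf1
  · simpa using key x b e 0 hx.orderOf_dvd he2
  · simpa using key x b f 1 hx.orderOf_dvd hf2
  · apply IsPiElement.of_pow_eq_one (n := a) (fun q hq h => piPart_prime_mem hq h)
    rw [← pow_mul, ← orderOf_dvd_iff_pow_eq_one]
    refine (orderOf_dvd_natCard x).trans ?_
    rw [← hmul, mul_comm]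
    exact mul_dvd_mul ((Nat.modEq_zero_iff_dvd).mp he2) dvd_rfl
  · apply IsPiElement.of_pow_eq_one (n := b) (fun q hq h => piPart_prime_mem hq h)
    rw [← pow_mul, ← orderOf_dvd_iff_pow_eq_one]
    refine (orderOf_dvd_natCard x).trans ?_
    rw [← hmul]
    exact mul_dvd_mul ((Nat.modEq_zero_iff_dvd).mp hf1) dvd_rfl
  · rw [← pow_add]
    have : e + f ≡ 1 [MOD a * b] := by
      rw [← Nat.modEq_and_modEq_iff_modEq_mul hab]
      exact ⟨by simpa using he1.add hf1, by simpa using he2.add hf2⟩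
    simpa using key x _ _ 1 (hmul ▸ orderOf_dvd_natCard x) this


/-! ### Counting classes -/

theorem piClass_mk {G : Type*} [Group G] {σ : Set ℕ} {x : G} :
    (∃ y : G, ConjClasses.mk y = ConjClasses.mk x ∧ IsPiElement σ y) ↔ IsPiElement σ x := by
  constructor
  · rintro ⟨y, h, hy⟩
    exact (isPiElement_conj_iff (ConjClasses.mk_eq_mk_iff_isConj.mp h)).mp hy
  · intro h
    exact ⟨x, rfl, h⟩

theorem card_carrier_mul_card_centralizer {G : Type*} [Group G] [Finite G] (g : G) :
    Nat.card (ConjClasses.mk g).carrier * Nat.card (Subgroup.centralizer {g}) = Nat.card G := by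
  rw [Subgroup.nat_card_centralizer_nat_card_stabilizer, ← ConjAct.orbit_eq_carrier_conjClasses]
  have h := MulAction.index_stabilizer (ConjAct G) g
  rw [← Nat.card_coe_set_eq] at h
  rw [← h, Subgroup.index_mul_card]
  rfl

theorem sum_centralizer_mul {G : Type*} [Group G] [Fintype G] (f : ConjClasses G → ℕ) :
    ∑ x : G, Nat.card (Subgroup.centralizer {x}) * f (ConjClasses.mk x)
      = Nat.card G * ∑ c : ConjClasses G, f c := by
  rw [← Finset.sum_fiberwise (s := Finset.univ) (g := fun x : G => ConjClasses.mk x),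
    Finset.mul_sum]
  refine Finset.sum_congr rfl fun c _ => ?_
  obtain ⟨y, rfl⟩ := ConjClasses.exists_rep c
  have hcard : (Finset.univ.filter fun x : G => ConjClasses.mk x = ConjClasses.mk y).card
      = Nat.card (ConjClasses.mk y).carrier := by
    rw [Nat.card_eq_fintype_card, Fintype.card_subtype]
    congr 1
    ext x
    simp [ConjClasses.mem_carrier_iff_mk_eq]
  have hpos : 0 < Nat.card (ConjClasses.mk y).carrier := by
    haveI : Nonempty (ConjClasses.mk y).carrier := ⟨⟨y, ConjClasses.mem_carrier_mk⟩⟩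
    exact Nat.card_pos
  rw [Finset.sum_congr rfl (g := fun _ =>
    Nat.card (Subgroup.centralizer {y}) * f (ConjClasses.mk y))]
  · rw [Finset.sum_const, hcard, smul_eq_mul, ← mul_assoc, card_carrier_mul_card_centralizer]
  · intro x hx
    have hx' : ConjClasses.mk x = ConjClasses.mk y := (Finset.mem_filter.mp hx).2
    have h1 := card_carrier_mul_card_centralizer x
    have h2 := card_carrier_mul_card_centralizer y
    rw [hx'] at h1 ⊢
    rw [Nat.eq_of_mul_eq_mul_left hpos (h1.trans h2.symm)]

theorem kPi_eq_sum {G : Type*} [Group G] [Fintype G] (σ : Set ℕ) :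
    kPi σ G = ∑ c : ConjClasses G,
      if (∃ y : G, ConjClasses.mk y = c ∧ IsPiElement σ y) then 1 else 0 := by
  unfold kPi
  rw [Nat.card_eq_fintype_card, Fintype.card_subtype, Finset.card_filter]
  rfl

theorem card_mul_kPi {G : Type*} [Group G] [Fintype G] (σ : Set ℕ) :
    Nat.card G * kPi σ G =
      ∑ x : G, if IsPiElement σ x then Nat.card (Subgroup.centralizer {x}) else 0 := by
  rw [kPi_eq_sum, ← sum_centralizer_mul]
  refine Finset.sum_congr rfl fun x _ => ?_
  rw [mul_ite, mul_one, mul_zero]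
  simp only [piClass_mk]

theorem kPi_le_of_hom {G H : Type*} [Group G] [Group H] [Finite H] {σ : Set ℕ} (f : H →* G)
    (hf : ∀ x : G, IsPiElement σ x → ∃ y : H, IsPiElement σ y ∧ IsConj (f y) x) :
    kPi σ G ≤ kPi σ H := by
  unfold kPi
  let F : {c : ConjClasses H | ∃ x : H, ConjClasses.mk x = c ∧ IsPiElement σ x} →
      {c : ConjClasses G | ∃ x : G, ConjClasses.mk x = c ∧ IsPiElement σ x} :=
    fun c => ⟨ConjClasses.map f c.1, by
      obtain ⟨x, hx, hx'⟩ := c.2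
      exact ⟨f x, by rw [← hx]; rfl, hx'.of_dvd (orderOf_map_dvd f x)⟩⟩
  apply Nat.card_le_card_of_surjective F
  rintro ⟨c, x, rfl, hx⟩
  obtain ⟨y, hy, hc⟩ := hf x hx
  refine ⟨⟨ConjClasses.mk y, y, rfl, hy⟩, ?_⟩
  apply Subtype.ext
  exact ConjClasses.mk_eq_mk_iff_isConj.mpr hc

theorem kPi_centralizer_le {G : Type*} [Group G] [Finite G] {σ : Set ℕ} {x y : G}
    (h : IsConj x y) :
    kPi σ (Subgroup.centralizer {x}) ≤ kPi σ (Subgroup.centralizer {y}) := by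
  obtain ⟨g, hg⟩ := isConj_iff.mp h
  let f : Subgroup.centralizer {y} →* Subgroup.centralizer {x} :=
    ((MulAut.conj g⁻¹).toMonoidHom.comp (Subgroup.subtype _)).codRestrict _ (by
      rintro ⟨z, hz⟩
      rw [Subgroup.mem_centralizer_singleton_iff] at hz ⊢
      simp only [MonoidHom.comp_apply, Subgroup.subtype_apply, MulEquiv.toMonoidHom_eq_coe,
        MonoidHom.coe_coe, MulAut.conj_apply, inv_inv]
      have : x = g⁻¹ * y * g := by rw [← hg]; group
      rw [this]
      calc g⁻¹ * z * g * (g⁻¹ * y * g) = g⁻¹ * (z * y) * g := by group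
        _ = g⁻¹ * (y * z) * g := by rw [hz]
        _ = _ := by group)
  apply kPi_le_of_hom f
  intro w hw
  refine ⟨⟨g * w * g⁻¹, ?_⟩, ?_, ?_⟩
  · have hw2 := w.2
    rw [Subgroup.mem_centralizer_singleton_iff] at hw2 ⊢
    rw [← hg]
    calc g * w * g⁻¹ * (g * x * g⁻¹) = g * (w * x) * g⁻¹ := by group
        _ = g * (x * w) * g⁻¹ := by rw [hw2]
        _ = _ := by group
  · rw [← isPiElement_coe]
    exact (isPiElement_conj_iff (isConj_iff.mpr ⟨g, rfl⟩)).mp (isPiElement_coe.mpr hw)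
  · have : f ⟨g * w * g⁻¹, by
        have hw2 := w.2
        rw [Subgroup.mem_centralizer_singleton_iff] at hw2 ⊢
        rw [← hg]
        calc g * w * g⁻¹ * (g * x * g⁻¹) = g * (w * x) * g⁻¹ := by group
          _ = g * (x * w) * g⁻¹ := by rw [hw2]
          _ = _ := by group⟩ = w := by
      apply Subtype.ext
      change g⁻¹ * (g * w * g⁻¹) * g⁻¹⁻¹ = w
      group
    rw [this]

theorem kPi_centralizer_eq {G : Type*} [Group G] [Finite G] {σ : Set ℕ} {x y : G}
    (h : IsConj x y) :
    kPi σ (Subgroup.centralizer {x}) = kPi σ (Subgroup.centralizer {y}) :=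
  le_antisymm (kPi_centralizer_le h) (kPi_centralizer_le h.symm)

theorem card_centralizer_mul {G : Type*} [Group G] [Finite G] {σ τ : Set ℕ}
    (hd : Disjoint σ τ) {x : G} (hx : IsPiElement σ x)
    (y : Subgroup.centralizer {x}) (hy : IsPiElement τ y) :
    Nat.card (Subgroup.centralizer {y}) = Nat.card (Subgroup.centralizer {x * (y : G)}) := by
  obtain ⟨e, f, hef⟩ := exists_exponents G σ
  have hyx : (y : G) * x = x * y := Subgroup.mem_centralizer_singleton_iff.mp y.2
  have hy' : IsPiElement σᶜ (y : G) :=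
    (isPiElement_coe.mpr hy).mono (Set.disjoint_left.mp hd.symm)
  have h1 : (x * (y : G)) ^ e = x := by
    rw [Commute.mul_pow hyx.symm, ((hef x).1 hx).1, ((hef y).2.1 hy').1, mul_one]
  have h2 : (x * (y : G)) ^ f = y := by
    rw [Commute.mul_pow hyx.symm, ((hef x).1 hx).2, ((hef y).2.1 hy').2, one_mul]
  refine Nat.card_congr
    { toFun := fun z => ⟨z.1.1, ?_⟩, invFun := fun z => ⟨⟨z.1, ?_⟩, ?_⟩,
      left_inv := fun z => rfl, right_inv := fun z => rfl }
  · have a1 := Subgroup.mem_centralizer_singleton_iff.mp z.1.2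
    have a2 := congrArg Subtype.val (Subgroup.mem_centralizer_singleton_iff.mp z.2)
    rw [Subgroup.mem_centralizer_singleton_iff]
    exact Commute.mul_right a1 a2
  · have a1 : Commute z.1 (x * (y : G)) := Subgroup.mem_centralizer_singleton_iff.mp z.2
    rw [Subgroup.mem_centralizer_singleton_iff]
    have := a1.pow_right e
    rw [h1] at this
    exact this
  · have a1 : Commute z.1 (x * (y : G)) := Subgroup.mem_centralizer_singleton_iff.mp z.2
    rw [Subgroup.mem_centralizer_singleton_iff]
    have := a1.pow_right f
    rw [h2] at this
    exact Subtype.ext this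

/-- The main reduction formula, as a sum over elements. -/
theorem card_mul_kPi_union {G : Type*} [Group G] [Fintype G] {σ τ : Set ℕ}
    (hd : Disjoint σ τ) :
    Nat.card G * kPi (σ ∪ τ) G = ∑ x : G, Nat.card (Subgroup.centralizer {x}) *
      (if IsPiElement σ x then kPi τ (Subgroup.centralizer {x}) else 0) := by
  rw [card_mul_kPi]
  obtain ⟨e, f, hef⟩ := exists_exponents G σ
  have hR : ∀ x : G, Nat.card (Subgroup.centralizer {x}) *
      (if IsPiElement σ x then kPi τ (Subgroup.centralizer {x}) else 0) =
      ∑ y : Subgroup.centralizer {x}, if IsPiElement σ x ∧ IsPiElement τ y then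
        Nat.card (Subgroup.centralizer {x * (y : G)}) else 0 := by
    intro x
    split_ifs with hx
    · rw [card_mul_kPi]
      refine Finset.sum_congr rfl fun y _ => ?_
      by_cases hy : IsPiElement τ y
      · rw [if_pos hy, if_pos ⟨hx, hy⟩, card_centralizer_mul hd hx y hy]
      · rw [if_neg hy, if_neg (fun h => hy h.2)]
    · rw [mul_zero]
      symm
      apply Finset.sum_eq_zero
      intro y _
      rw [if_neg (fun h => hx h.1)]
  rw [Finset.sum_congr rfl (fun x _ => hR x), Finset.sum_sigma', ← Finset.sum_filter,
    ← Finset.sum_filter]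
  have hdc : τ ⊆ σᶜ := fun q hq hq' => Set.disjoint_left.mp hd hq' hq
  refine Finset.sum_bij' (fun z _ => ⟨z ^ e, ⟨z ^ f, ?_⟩⟩) (fun w _ => w.1 * (w.2 : G))
    ?_ ?_ ?_ ?_ ?_
  · rw [Subgroup.mem_centralizer_singleton_iff]
    exact ((Commute.refl z).pow_pow f e)
  · intro z hz
    simp only [Finset.mem_filter, Finset.mem_univ, true_and, Finset.mem_sigma] at hz ⊢
    refine ⟨(hef z).2.2.1, ?_⟩
    rw [← isPiElement_coe]
    intro q hq hdvd
    have a1 := (hef z).2.2.2.1 q hq hdvd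
    have a2 := (hz.pow f) q hq hdvd
    exact a2.resolve_left a1
  · rintro ⟨x, y⟩ hw
    simp only [Finset.mem_filter, Finset.mem_univ, true_and, Finset.mem_sigma] at hw ⊢
    have hyx : (y : G) * x = x * y := Subgroup.mem_centralizer_singleton_iff.mp y.2
    intro q hq hdvd
    have a1 : q ∣ orderOf x * orderOf (y : G) :=
      hdvd.trans ((Commute.orderOf_mul_dvd_lcm hyx.symm).trans (Nat.lcm_dvd_mul _ _))
    rcases (hq.dvd_mul).mp a1 with h | h
    · exact Or.inl (hw.1 q hq h)
    · exact Or.inr (isPiElement_coe.mpr hw.2 q hq h)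
  · intro z _
    exact (hef z).2.2.2.2
  · rintro ⟨x, y⟩ hw
    simp only [Finset.mem_filter, Finset.mem_univ, true_and, Finset.mem_sigma] at hw
    have hyx : (y : G) * x = x * y := Subgroup.mem_centralizer_singleton_iff.mp y.2
    have hy' : IsPiElement σᶜ (y : G) := (isPiElement_coe.mpr hw.2).mono hdc
    have h1 : (x * (y : G)) ^ e = x := by
      rw [Commute.mul_pow hyx.symm, ((hef x).1 hw.1).1, ((hef y).2.1 hy').1, mul_one]
    have h2 : (x * (y : G)) ^ f = y := by
      rw [Commute.mul_pow hyx.symm, ((hef x).1 hw.1).2, ((hef y).2.1 hy').2, one_mul]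
    have key : ∀ (a : G) (b : G) (hb : b ∈ Subgroup.centralizer {a}), a = x → b = y →
        (⟨a, ⟨b, hb⟩⟩ : (x : G) × Subgroup.centralizer {x}) = ⟨x, y⟩ := by
      rintro a b hb rfl rfl
      rfl
    exact key _ _ _ h1 h2
  · intro z _
    simp only
    rw [(hef z).2.2.2.2]

/-- The main reduction formula, as a sum over classes. -/
theorem kPi_union {G : Type*} [Group G] [Fintype G] {σ τ : Set ℕ}
    (hd : Disjoint σ τ) :
    kPi (σ ∪ τ) G = ∑ c : ConjClasses G,
      if (∃ y : G, ConjClasses.mk y = c ∧ IsPiElement σ y) then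
        kPi τ (Subgroup.centralizer {Quotient.out c}) else 0 := by
  have h := card_mul_kPi_union (G := G) hd
  apply Nat.eq_of_mul_eq_mul_left (Nat.card_pos (α := G))
  rw [h, ← sum_centralizer_mul]
  refine Finset.sum_congr rfl fun x _ => ?_
  simp only [piClass_mk]
  congr 2
  apply kPi_centralizer_eq
  apply ConjClasses.mk_eq_mk_iff_isConj.mp
  exact (Quotient.out_eq (ConjClasses.mk x)).symm

theorem kPi_congr {G : Type*} [Group G] {σ τ : Set ℕ} [Finite G]
    (h : ∀ q : ℕ, q.Prime → q ∣ Nat.card G → (q ∈ σ ↔ q ∈ τ)) : kPi σ G = kPi τ G := by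
  unfold kPi
  congr 1
  have : ∀ x : G, IsPiElement σ x ↔ IsPiElement τ x := by
    intro x
    constructor
    · intro hx q hq hd
      exact (h q hq (hd.trans (orderOf_dvd_natCard x))).mp (hx q hq hd)
    · intro hx q hq hd
      exact (h q hq (hd.trans (orderOf_dvd_natCard x))).mpr (hx q hq hd)
  simp only [this]


/-! ### Coprime actions and orbit counting -/

/-- Subgroup of fixed points of `g`. -/
def fixSub {N P : Type*} [Group N] [Group P] [MulDistribMulAction N P] (g : N) : Subgroup P where
  carrier := {x | g • x = x}
  mul_mem' := by
    intro a b ha hb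
    simp only [Set.mem_setOf_eq] at *
    rw [smul_mul', ha, hb]
  one_mem' := smul_one g
  inv_mem' := by
    intro a ha
    simp only [Set.mem_setOf_eq] at *
    rw [smul_inv', ha]

theorem mem_fixSub {N P : Type*} [Group N] [Group P] [MulDistribMulAction N P] {g : N} {x : P} :
    x ∈ fixSub g ↔ g • x = x := Iff.rfl

/-- Kernel of the action. -/
def actKer (N P : Type*) [Group N] [Group P] [MulDistribMulAction N P] : Subgroup N :=
  (MulDistribMulAction.toMulAut N P).ker

instance actKer_normal (N P : Type*) [Group N] [Group P] [MulDistribMulAction N P] :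
    (actKer N P).Normal := by
  unfold actKer; infer_instance

theorem mem_actKer {N P : Type*} [Group N] [Group P] [MulDistribMulAction N P] {g : N} :
    g ∈ actKer N P ↔ ∀ x : P, g • x = x := by
  unfold actKer
  rw [MonoidHom.mem_ker, DFunLike.ext_iff]
  rfl

theorem sum_fix {N P : Type*} [Group N] [Group P] [MulDistribMulAction N P] [Fintype N]
    [Finite P] :
    ∑ g : N, Nat.card (fixSub g : Subgroup P) =
      Nat.card (MulAction.orbitRel.Quotient N P) * Nat.card N := by
  have : Fintype P := Fintype.ofFinite P
  have h := MulAction.sum_card_fixedBy_eq_card_orbits_mul_card_group N P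
  rw [← Nat.card_eq_fintype_card, ← Nat.card_eq_fintype_card] at h
  rw [← h]
  refine Finset.sum_congr rfl fun g _ => ?_
  rw [← Nat.card_eq_fintype_card]
  rfl

theorem orbits_bound {N P : Type*} [Group N] [Group P] [MulDistribMulAction N P] [Finite N]
    [Finite P] (d : ℕ) (hd : ∀ g : N, g ∉ actKer N P →
      d * Nat.card (fixSub g : Subgroup P) ≤ Nat.card P) :
    d * (actKer N P).index * Nat.card (MulAction.orbitRel.Quotient N P)
      + Nat.card P ≤ (d + (actKer N P).index) * Nat.card P := by
  have : Fintype N := Fintype.ofFinite N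
  have h := sum_fix (N := N) (P := P)
  have hN := (actKer N P).index_mul_card
  have hk : 0 < Nat.card (actKer N P) := Nat.card_pos
  have hkc : (Finset.univ.filter fun g : N => g ∈ actKer N P).card = Nat.card (actKer N P) := by
    rw [Nat.card_eq_fintype_card, Fintype.card_subtype]
  have hkc' : (Finset.univ.filter fun g : N => g ∉ actKer N P).card + Nat.card (actKer N P)
      = Nat.card N := by
    rw [← hkc, add_comm, Finset.card_filter_add_card_filter_not, Finset.card_univ,
      Nat.card_eq_fintype_card]
  have h1 : d * ∑ g : N, Nat.card (fixSub g : Subgroup P) ≤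
      d * (Nat.card (actKer N P) * Nat.card P) +
      (Finset.univ.filter fun g : N => g ∉ actKer N P).card * Nat.card P := by
    rw [← Finset.sum_filter_add_sum_filter_not Finset.univ (fun g => g ∈ actKer N P), mul_add]
    apply add_le_add
    · apply Nat.mul_le_mul_left
      rw [← hkc, ← smul_eq_mul]
      apply Finset.sum_le_card_nsmul
      intro g _
      exact Subgroup.card_le_card_group _
    · rw [Finset.mul_sum, ← smul_eq_mul]
      apply Finset.sum_le_card_nsmul
      intro g hg
      exact hd g (Finset.mem_filter.mp hg).2
  rw [h] at h1
  set m := (actKer N P).index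
  set k := Nat.card (actKer N P)
  set r := (Finset.univ.filter fun g : N => g ∉ actKer N P).card
  set Q := Nat.card P
  set w := Nat.card (MulAction.orbitRel.Quotient N P)
  have h2 : d * (w * (m * k)) + k * Q ≤ d * (k * Q) + (m * k) * Q := by
    rw [hN, ← hkc', add_mul, ← add_assoc]
    rw [← hkc'] at h1
    exact Nat.add_le_add_right h1 _
  apply Nat.le_of_mul_le_mul_left _ hk
  calc k * (d * m * w + Q) = d * (w * (m * k)) + k * Q := by ring
    _ ≤ _ := h2
    _ = _ := by ring

theorem fix_index_dvd {N P : Type*} [Group N] [Group P] [MulDistribMulAction N P]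
    [Finite P] {p : ℕ} [hp : Fact p.Prime] (hP : IsPGroup p P) {g : N} (hg : g ∉ actKer N P) :
    ∃ j : ℕ, (fixSub g : Subgroup P).index = p ^ (j + 1) := by
  obtain ⟨n, hn⟩ := hP.exists_card_eq
  have h1 : (fixSub g : Subgroup P).index ∣ p ^ n := hn ▸ Subgroup.index_dvd_card _
  obtain ⟨j, _, hj⟩ := (Nat.dvd_prime_pow hp.out).mp h1
  cases j with
  | zero =>
    exfalso
    rw [pow_zero, Subgroup.index_eq_one] at hj
    apply hg
    rw [mem_actKer]
    intro x
    rw [← mem_fixSub, hj]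
    trivial
  | succ j => exact ⟨j, hj⟩

theorem fix_index_ne_two {N P : Type*} [Group N] [Group P] [MulDistribMulAction N P] [Finite N]
    [Finite P] {p : ℕ} [hp : Fact p.Prime] (hP : IsPGroup p P) (hK : ¬ p ∣ (actKer N P).index)
    {g : N} (hg : g ∉ actKer N P) : (fixSub g : Subgroup P).index ≠ 2 := by
  intro h2
  obtain ⟨n, hn⟩ := hP.exists_card_eq
  apply hg
  have hstab : ∀ x : P, g • x ∈ (fixSub g : Subgroup P) → x ∈ (fixSub g : Subgroup P) := by
    intro x hx
    rw [mem_fixSub] at hx ⊢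
    exact smul_left_cancel g hx
  have h3 : ∀ x : P, x⁻¹ * g • x ∈ (fixSub g : Subgroup P) := by
    intro x
    rw [Subgroup.mul_mem_iff_of_index_two h2, inv_mem_iff]
    constructor
    · intro hx; rw [mem_fixSub] at hx; rw [hx]; exact hx
    · exact hstab x
  have h4 : ∀ (x : P) (k : ℕ), g ^ k • x = x * (x⁻¹ * g • x) ^ k := by
    intro x k
    induction k with
    | zero => simp
    | succ k ih =>
      have hfix : g • (x⁻¹ * g • x) = x⁻¹ * g • x := h3 x
      rw [pow_succ', mul_smul, ih, smul_mul', smul_pow', hfix, pow_succ', ← mul_assoc, mul_inv_cancel_left]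
  have h5 : g ^ (p ^ n) ∈ actKer N P := by
    rw [mem_actKer]
    intro x
    rw [h4, ← hn, pow_card_eq_one', mul_one]
  have h6 : g ^ (actKer N P).index ∈ actKer N P := Subgroup.pow_index_mem _ g
  have hc : Nat.Coprime (p ^ n) (actKer N P).index :=
    Nat.Coprime.pow_left _ ((Nat.Prime.coprime_iff_not_dvd hp.out).mpr hK)
  have h7 := Subgroup.zpow_mem _ h5 (Nat.gcdA (p ^ n) (actKer N P).index)
  have h8 := Subgroup.zpow_mem _ h6 (Nat.gcdB (p ^ n) (actKer N P).index)
  have h9 := Subgroup.mul_mem _ h7 h8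
  rw [← zpow_natCast, ← zpow_natCast, ← zpow_mul, ← zpow_mul, ← zpow_add,
    ← Nat.gcd_eq_gcd_ab, hc, Nat.cast_one, zpow_one] at h9
  exact h9

theorem orbits_eq_of_trivial {N P : Type*} [Group N] [Group P] [MulDistribMulAction N P]
    [Finite N] [Finite P] (hK : actKer N P = ⊤) :
    Nat.card (MulAction.orbitRel.Quotient N P) = Nat.card P := by
  have : Fintype N := Fintype.ofFinite N
  have h := sum_fix (N := N) (P := P)
  have h1 : ∀ g : N, Nat.card (fixSub g : Subgroup P) = Nat.card P := by
    intro g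
    have : (fixSub g : Subgroup P) = ⊤ := by
      rw [eq_top_iff]
      intro x _
      have hg : g ∈ actKer N P := hK ▸ Subgroup.mem_top g
      exact mem_actKer.mp hg x
    rw [this, Subgroup.card_top]
  simp only [h1, Finset.sum_const, Finset.card_univ, smul_eq_mul] at h
  rw [Nat.card_eq_fintype_card (α := N), mul_comm] at h
  exact (Nat.eq_of_mul_eq_mul_right Fintype.card_pos h).symm

theorem orbits_two {N P : Type*} [Group N] [Group P] [MulDistribMulAction N P]
    [Finite N] [Finite P] (hK : (actKer N P).index = 2) {t : N} (ht : t ∉ actKer N P) :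
    2 * Nat.card (MulAction.orbitRel.Quotient N P)
      = Nat.card P + Nat.card (fixSub t : Subgroup P) := by
  have : Fintype N := Fintype.ofFinite N
  have h := sum_fix (N := N) (P := P)
  have hN := (actKer N P).index_mul_card
  have hk : 0 < Nat.card (actKer N P) := Nat.card_pos
  have hkc : (Finset.univ.filter fun g : N => g ∈ actKer N P).card = Nat.card (actKer N P) := by
    rw [Nat.card_eq_fintype_card, Fintype.card_subtype]
  have hkc' : (Finset.univ.filter fun g : N => g ∉ actKer N P).card + Nat.card (actKer N P)
      = Nat.card N := by
    rw [← hkc, add_comm, Finset.card_filter_add_card_filter_not, Finset.card_univ,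
      Nat.card_eq_fintype_card]
  rw [← Finset.sum_filter_add_sum_filter_not Finset.univ (fun g => g ∈ actKer N P)] at h
  rw [Finset.sum_congr rfl (g := fun _ => Nat.card P),
    Finset.sum_congr rfl (s₁ := Finset.univ.filter fun g : N => g ∉ actKer N P)
      (g := fun _ => Nat.card (fixSub t : Subgroup P)),
    Finset.sum_const, Finset.sum_const, hkc, smul_eq_mul, smul_eq_mul] at h
  · have hr : (Finset.univ.filter fun g : N => g ∉ actKer N P).card
        = Nat.card (actKer N P) := by
      rw [hK] at hN; omega
    rw [hr, ← hN, hK] at h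
    apply Nat.eq_of_mul_eq_mul_left hk
    linarith
  · intro g hg
    have hg := (Finset.mem_filter.mp hg).2
    have h1 : t⁻¹ * g ∈ actKer N P := by
      rw [Subgroup.mul_mem_iff_of_index_two hK, inv_mem_iff]
      exact ⟨fun h => absurd h ht, fun h => absurd h hg⟩
    have h2 : (fixSub g : Subgroup P) = fixSub t := by
      ext x
      rw [mem_fixSub, mem_fixSub]
      have h3 : g • x = t • x := by
        have := mem_actKer.mp h1 x
        rw [mul_smul, inv_smul_eq_iff] at this
        exact this
      rw [h3]
    rw [h2]
  · intro g hg
    have hg := (Finset.mem_filter.mp hg).2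
    have : (fixSub g : Subgroup P) = ⊤ := by
      rw [eq_top_iff]
      intro x _
      exact mem_actKer.mp hg x
    rw [this, Subgroup.card_top]

theorem orbits_dichotomy {N P : Type*} [Group N] [Group P] [MulDistribMulAction N P] [Finite N]
    [Finite P] {p : ℕ} [hp : Fact p.Prime] (hP : IsPGroup p P) (hK : ¬ p ∣ (actKer N P).index)
    (hne : actKer N P ≠ ⊤) :
    8 * Nat.card (MulAction.orbitRel.Quotient N P) ≤ 5 * Nat.card P ∨
      (p = 3 ∧ 3 * Nat.card (MulAction.orbitRel.Quotient N P) = 2 * Nat.card P) := by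
  have hm0 : (actKer N P).index ≠ 0 := Subgroup.index_ne_zero_of_finite
  have hm1 : (actKer N P).index ≠ 1 := by rwa [Ne, Subgroup.index_eq_one]
  have hdb : ∀ (d : ℕ) (g : N), d ≤ (fixSub g : Subgroup P).index →
      d * Nat.card (fixSub g : Subgroup P) ≤ Nat.card P := by
    intro d g h
    rw [← (fixSub g : Subgroup P).index_mul_card]
    exact Nat.mul_le_mul_right _ h
  have hple : ∀ g : N, g ∉ actKer N P → p ≤ (fixSub g : Subgroup P).index := by
    intro g hg
    obtain ⟨j, hj⟩ := fix_index_dvd hP hg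
    rw [hj]
    exact Nat.le_self_pow (Nat.succ_ne_zero j) p
  have hp2 := hp.out.two_le
  set m := (actKer N P).index with hm
  set w := Nat.card (MulAction.orbitRel.Quotient N P)
  by_cases h3 : p = 3
  · by_cases hm2 : m = 2
    · obtain ⟨t, ht⟩ : ∃ t, t ∉ actKer N P := by
        by_contra hcon
        push Not at hcon
        exact hne (eq_top_iff.mpr fun x _ => hcon x)
      have h2 := orbits_two hm2 ht
      obtain ⟨j, hj⟩ := fix_index_dvd hP ht
      have hi := (fixSub t : Subgroup P).index_mul_card
      rw [hj] at hi
      cases j with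
      | zero =>
        right
        refine ⟨h3, ?_⟩
        rw [h3] at hi
        simp only [zero_add, pow_one] at hi
        omega
      | succ j =>
        left
        have : 9 * Nat.card (fixSub t : Subgroup P) ≤ Nat.card P := by
          apply hdb
          rw [hj, h3, pow_succ, pow_succ]
          have : 0 < 3 ^ j := by positivity
          omega
        omega
    · left
      have hb := orbits_bound (N := N) (P := P) 3 (fun g hg => hdb 3 g (h3 ▸ hple g hg))
      rw [← hm] at hb
      have hm3 : 3 ≤ m := by omega
      refine le_of_mul_le_mul_left (a := 3 * m) ?_ (by omega)
      nlinarith [Nat.mul_le_mul_right (Nat.card P) hm3]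
  · left
    have h4 : ∀ g : N, g ∉ actKer N P → 4 ≤ (fixSub g : Subgroup P).index := by
      intro g hg
      by_cases hp4 : p = 2
      · obtain ⟨j, hj⟩ := fix_index_dvd hP hg
        have hn2 := fix_index_ne_two hP hK hg
        rw [hj, hp4] at hn2 ⊢
        cases j with
        | zero => simp at hn2
        | succ j =>
          rw [pow_succ, pow_succ]
          have : 0 < 2 ^ j := by positivity
          omega
      · have := hple g hg
        have : p ≠ 4 := by rintro rfl; exact absurd hp.out (by norm_num)
        omega
    have hb := orbits_bound (N := N) (P := P) 4 (fun g hg => hdb 4 g (h4 g hg))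
    rw [← hm] at hb
    have hm2 : 2 ≤ m := by omega
    refine le_of_mul_le_mul_left (a := m) ?_ (by omega)
    nlinarith [Nat.mul_le_mul_right (Nat.card P) hm2]

/-- The theorem of Gustafson. -/
theorem five_eighths {P : Type*} [Group P] [Finite P] (h : ¬ ∀ a b : P, a * b = b * a) :
    8 * Nat.card (ConjClasses P) ≤ 5 * Nat.card P := by
  have : Fintype P := Fintype.ofFinite P
  have hs := sum_centralizer_mul (G := P) (fun _ => 1)
  simp only [mul_one, Finset.sum_const, Finset.card_univ, smul_eq_mul] at hs
  rw [← Nat.card_eq_fintype_card] at hs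
  have hzi : 4 ≤ (Subgroup.center P).index := by
    by_contra hlt
    apply h
    have h0 : (Subgroup.center P).index ≠ 0 := Subgroup.index_ne_zero_of_finite
    have hcyc : IsCyclic (P ⧸ Subgroup.center P) := by
      have hc : (Subgroup.center P).index = 1 ∨ (Subgroup.center P).index = 2 ∨
        (Subgroup.center P).index = 3 := by omega
      rw [Subgroup.index_eq_card] at hc
      rcases hc with hc | hc | hc
      · have := (Nat.card_eq_one_iff_unique.mp hc).1
        infer_instance
      · have := Fact.mk Nat.prime_two
        exact isCyclic_of_prime_card hc
      · have := Fact.mk Nat.prime_three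
        exact isCyclic_of_prime_card hc
    exact commutative_of_cyclic_center_quotient (QuotientGroup.mk' (Subgroup.center P))
      (by rw [QuotientGroup.ker_mk'])
  have hz4 : 4 * Nat.card (Subgroup.center P) ≤ Nat.card P := by
    rw [← (Subgroup.center P).index_mul_card]
    exact Nat.mul_le_mul_right _ hzi
  have hkc : (Finset.univ.filter fun g : P => g ∈ Subgroup.center P).card
      = Nat.card (Subgroup.center P) := by
    rw [Nat.card_eq_fintype_card, Fintype.card_subtype]
  have hkc' : (Finset.univ.filter fun g : P => g ∉ Subgroup.center P).card
      + Nat.card (Subgroup.center P) = Nat.card P := by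
    rw [← hkc, add_comm, Finset.card_filter_add_card_filter_not, Finset.card_univ,
      Nat.card_eq_fintype_card]
  have h1 : 2 * ∑ g : P, Nat.card (Subgroup.centralizer {g}) ≤
      2 * (Nat.card (Subgroup.center P) * Nat.card P) +
      (Finset.univ.filter fun g : P => g ∉ Subgroup.center P).card * Nat.card P := by
    rw [← Finset.sum_filter_add_sum_filter_not Finset.univ (fun g => g ∈ Subgroup.center P),
      mul_add]
    apply add_le_add
    · apply Nat.mul_le_mul_left
      rw [← hkc, ← smul_eq_mul]
      apply Finset.sum_le_card_nsmul
      intro g _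
      exact Subgroup.card_le_card_group _
    · rw [Finset.mul_sum, ← smul_eq_mul]
      apply Finset.sum_le_card_nsmul
      intro g hg
      have hg := (Finset.mem_filter.mp hg).2
      rw [← (Subgroup.centralizer {g}).index_mul_card]
      apply Nat.mul_le_mul_right
      have a0 : (Subgroup.centralizer {g}).index ≠ 0 := Subgroup.index_ne_zero_of_finite
      have a1 : (Subgroup.centralizer {g}).index ≠ 1 := by
        rw [Ne, Subgroup.index_eq_one]
        intro htop
        apply hg
        rw [Subgroup.mem_center_iff]
        intro x
        have : x ∈ Subgroup.centralizer {g} := htop ▸ Subgroup.mem_top x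
        exact Subgroup.mem_centralizer_singleton_iff.mp this
      omega
  rw [hs] at h1
  have hpos : 0 < Nat.card P := Nat.card_pos
  have h2 : 2 * Nat.card (ConjClasses P) ≤ 2 * Nat.card (Subgroup.center P) +
      (Finset.univ.filter fun g : P => g ∉ Subgroup.center P).card := by
    apply Nat.le_of_mul_le_mul_left _ hpos
    linarith
  omega



/-! ### The single prime case -/

theorem isPi_of_mem_sylow {G : Type*} [Group G] {p : ℕ} [hp : Fact p.Prime]
    (P : Sylow p G) {x : G} (hx : x ∈ P) : IsPiElement {p} x := by
  obtain ⟨k, hk⟩ := IsPGroup.iff_orderOf.mp P.isPGroup' ⟨x, hx⟩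
  rw [Subgroup.orderOf_mk] at hk
  intro q hq hd
  rw [hk] at hd
  exact (Nat.prime_dvd_prime_iff_eq hq hp.out).mp (hq.dvd_of_dvd_pow hd)

theorem exists_conj_mem_sylow {G : Type*} [Group G] [Finite G] {p : ℕ} [hp : Fact p.Prime]
    (P : Sylow p G) {x : G} (hx : IsPiElement {p} x) : ∃ y : G, y ∈ P ∧ IsConj y x := by
  have h1 : IsPGroup p (Subgroup.zpowers x) := by
    apply IsPGroup.of_card (n := (orderOf x).factorization p)
    rw [Nat.card_zpowers, ← piPart_singleton hp.out]
    exact (piPart_eq_self (orderOf_pos x).ne' hx).symm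
  obtain ⟨Q, hQ⟩ := h1.exists_le_sylow
  obtain ⟨g, hg⟩ := MulAction.exists_smul_eq G P Q
  have h2 : x ∈ g • P := hg ▸ hQ (Subgroup.mem_zpowers x)
  have h3 : x ∈ MulAut.conj g • (P : Subgroup G) := h2
  rw [Subgroup.mem_pointwise_smul_iff_inv_smul_mem] at h3
  refine ⟨_, h3, ?_⟩
  rw [isConj_iff]
  refine ⟨g, ?_⟩
  simp [MulAut.smul_def, ← map_inv]
  group

theorem piPart_sylow {G : Type*} [Group G] [Finite G] {p : ℕ} [hp : Fact p.Prime]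
    (P : Sylow p G) : piPart {p} (Nat.card G) = Nat.card P := by
  rw [piPart_singleton hp.out]; exact P.card_eq_multiplicity.symm

theorem kPi_le_card_conj (σ : Set ℕ) (P : Type*) [Group P] [Finite P] :
    kPi σ P ≤ Nat.card (ConjClasses P) := by
  unfold kPi
  exact Nat.card_le_card_of_injective _ Subtype.val_injective

theorem card_conj_le (P : Type*) [Group P] [Finite P] : Nat.card (ConjClasses P) ≤ Nat.card P :=
  Nat.card_le_card_of_surjective ConjClasses.mk ConjClasses.mk_surjective

theorem kPi_le_sylow {G : Type*} [Group G] [Finite G] {p : ℕ} [hp : Fact p.Prime]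
    (P : Sylow p G) : kPi {p} G ≤ kPi {p} P := by
  apply kPi_le_of_hom (P : Subgroup G).subtype
  intro x hx
  obtain ⟨y, hy, hc⟩ := exists_conj_mem_sylow P hx
  exact ⟨⟨y, hy⟩, isPiElement_coe.mp (isPi_of_mem_sylow P hy), hc⟩

theorem kPi_prime_le {G : Type*} [Group G] [Finite G] {p : ℕ} (hp : p.Prime) :
    kPi {p} G ≤ piPart {p} (Nat.card G) := by
  have : Fact p.Prime := ⟨hp⟩
  obtain ⟨P⟩ : Nonempty (Sylow p G) := inferInstance
  rw [piPart_sylow P]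
  exact (kPi_le_sylow P).trans ((kPi_le_card_conj _ _).trans (card_conj_le _))

theorem kPi_eq_orbits {G : Type*} [Group G] [Finite G] {p : ℕ} [hp : Fact p.Prime]
    (P : Sylow p G) (hc : ∀ a b : P, a * b = b * a) :
    Nat.card (MulAction.orbitRel.Quotient (Subgroup.normalizer ((P : Subgroup G) : Set G))
      (P : Subgroup G)) = kPi {p} G := by
  have : IsMulCommutative (P : Subgroup G) := ⟨⟨hc⟩⟩
  let F : MulAction.orbitRel.Quotient (Subgroup.normalizer ((P : Subgroup G) : Set G))
      (P : Subgroup G) →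
      {c : ConjClasses G | ∃ x : G, ConjClasses.mk x = c ∧ IsPiElement {p} x} :=
    Quotient.lift (fun x : (P : Subgroup G) =>
      (⟨ConjClasses.mk (x : G), x, rfl, isPi_of_mem_sylow P x.2⟩ :
        {c : ConjClasses G | ∃ x : G, ConjClasses.mk x = c ∧ IsPiElement {p} x})) (by
      rintro a b ⟨n, hn⟩
      apply Subtype.ext
      have h1 : (n : G) * b * (n : G)⁻¹ = a := congrArg Subtype.val hn
      exact (ConjClasses.mk_eq_mk_iff_isConj.mpr (isConj_iff.mpr ⟨(n : G), h1⟩)).symm)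
  apply Nat.card_eq_of_bijective F
  constructor
  · intro a b
    induction a using Quotient.inductionOn with | _ a
    induction b using Quotient.inductionOn with | _ b
    intro h
    have h1 : ConjClasses.mk (a : G) = ConjClasses.mk (b : G) := congrArg Subtype.val h
    rw [ConjClasses.mk_eq_mk_iff_isConj, isConj_iff] at h1
    obtain ⟨g, hg⟩ := h1
    have hg' : g⁻¹⁻¹ * (a : G) * g⁻¹ = b := by rw [inv_inv]; exact hg
    obtain ⟨n, hn, hn'⟩ := P.conj_eq_normalizer_conj_of_mem (a : G) g⁻¹ a.2 (hg' ▸ b.2)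
    apply Quotient.sound
    refine ⟨⟨n, hn⟩, ?_⟩
    apply Subtype.ext
    change n * (b : G) * n⁻¹ = a
    rw [← hg', hn']
    group
  · rintro ⟨c, x, rfl, hx⟩
    obtain ⟨y, hy, hyc⟩ := exists_conj_mem_sylow P hx
    exact ⟨Quotient.mk _ ⟨y, hy⟩, Subtype.ext (ConjClasses.mk_eq_mk_iff_isConj.mpr hyc)⟩

theorem mem_actKer_normalizer {G : Type*} [Group G] {H : Subgroup G}
    {n : Subgroup.normalizer (H : Set G)} :
    n ∈ actKer (Subgroup.normalizer (H : Set G)) H ↔ (n : G) ∈ Subgroup.centralizer (H : Set G) := by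
  rw [mem_actKer, Subgroup.mem_centralizer_iff]
  constructor
  · intro h x hx
    have := congrArg Subtype.val (h ⟨x, hx⟩)
    change (n : G) * x * (n : G)⁻¹ = x at this
    rw [mul_inv_eq_iff_eq_mul] at this
    exact this.symm
  · intro h x
    apply Subtype.ext
    change (n : G) * x * (n : G)⁻¹ = x
    rw [mul_inv_eq_iff_eq_mul]
    exact (h x x.2).symm

theorem single_prime {G : Type*} [Group G] [Finite G] {p : ℕ} [hp : Fact p.Prime]
    (P : Sylow p G) (h : 5 * Nat.card P < 8 * kPi {p} G) :
    (∀ a b : P, a * b = b * a) ∧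
    ((Subgroup.normalizer ((P : Subgroup G) : Set G) ≤
        Subgroup.centralizer ((P : Subgroup G) : Set G) ∧ kPi {p} G = Nat.card P) ∨
      (p = 3 ∧ 3 * kPi {p} G = 2 * Nat.card P ∧
        ¬ Subgroup.normalizer ((P : Subgroup G) : Set G) ≤
        Subgroup.centralizer ((P : Subgroup G) : Set G))) := by
  have hc : ∀ a b : P, a * b = b * a := by
    by_contra hc
    have h1 : 8 * Nat.card (ConjClasses (P : Subgroup G)) ≤ 5 * Nat.card (P : Subgroup G) :=
      five_eighths hc
    change 5 * Nat.card (P : Subgroup G) < 8 * kPi {p} G at h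
    have h2 : kPi {p} G ≤ Nat.card (ConjClasses (P : Subgroup G)) := (kPi_le_sylow P).trans (kPi_le_card_conj _ _)
    omega
  refine ⟨hc, ?_⟩
  have ho := kPi_eq_orbits P hc
  by_cases hk : actKer (Subgroup.normalizer ((P : Subgroup G) : Set G)) (P : Subgroup G) = ⊤
  · left
    constructor
    · intro n hn
      exact mem_actKer_normalizer (n := ⟨n, hn⟩).mp (hk ▸ Subgroup.mem_top _)
    · rw [← ho, orbits_eq_of_trivial hk]
  · right
    have hind : ¬ p ∣
        (actKer (Subgroup.normalizer ((P : Subgroup G) : Set G)) (P : Subgroup G)).index := by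
      intro hd
      have h1 : (P : Subgroup G).subgroupOf (Subgroup.normalizer ((P : Subgroup G) : Set G)) ≤
          actKer (Subgroup.normalizer ((P : Subgroup G) : Set G)) (P : Subgroup G) := by
        intro n hn
        rw [mem_actKer_normalizer, Subgroup.mem_centralizer_iff]
        intro x hx
        exact congrArg Subtype.val (hc ⟨x, hx⟩ ⟨n, hn⟩)
      have h2 := hd.trans (Subgroup.index_dvd_of_le h1)
      have h3 : (P : Subgroup G).relIndex (Subgroup.normalizer ((P : Subgroup G) : Set G)) ∣
        (P : Subgroup G).index := Subgroup.relIndex_dvd_index_of_le Subgroup.le_normalizer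
      exact P.not_dvd_index (h2.trans h3)
    rcases orbits_dichotomy P.isPGroup' hind hk with h1 | ⟨h1, h2⟩
    · rw [ho] at h1
      exfalso
      change 8 * kPi {p} G ≤ 5 * Nat.card P at h1
      omega
    · refine ⟨h1, by rw [← ho]; exact h2, ?_⟩
      intro hle
      apply hk
      rw [eq_top_iff]
      intro n _
      exact mem_actKer_normalizer.mpr (hle n.2)


/-! ### General bounds -/

theorem kPi_union_le {G : Type*} [Group G] [Finite G] {σ τ : Set ℕ} (hd : Disjoint σ τ) (M : ℕ)
    (hM : ∀ x : G, IsPiElement σ x → kPi τ (Subgroup.centralizer {x}) ≤ M) :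
    kPi (σ ∪ τ) G ≤ kPi σ G * M := by
  have : Fintype G := Fintype.ofFinite G
  rw [kPi_union hd, kPi_eq_sum, Finset.sum_mul]
  apply Finset.sum_le_sum
  intro c _
  split_ifs with h
  · rw [one_mul]
    apply hM
    rw [← piClass_mk]
    have : ConjClasses.mk (Quotient.out c) = c := Quotient.out_eq c
    rw [this]
    exact h
  · simp

theorem kPi_empty_le (G : Type*) [Group G] : kPi ∅ G ≤ 1 := by
  have h : kPi ∅ G ≤ kPi ∅ PUnit.{1} := by
    apply kPi_le_of_hom (1 : PUnit.{1} →* G)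
    intro x hx
    have hx1 : x = 1 := by
      rw [← orderOf_eq_one_iff]
      by_contra hne
      obtain ⟨q, hq, hd⟩ := Nat.exists_prime_and_dvd hne
      exact hx q hq hd
    refine ⟨1, ?_, by rw [hx1]; simp⟩
    intro q hq hd
    rw [orderOf_one] at hd
    exact absurd (Nat.dvd_one.mp hd) hq.ne_one
  refine h.trans ((kPi_le_card_conj _ _).trans ((card_conj_le _).trans ?_))
  simp

theorem kPi_le_finset.{u} (s : Finset ℕ) : (∀ p ∈ s, p.Prime) → ∀ (G : Type u) [Group G] [Finite G],
    kPi (s : Set ℕ) G ≤ piPart (s : Set ℕ) (Nat.card G) := by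
  induction s using Finset.induction_on with
  | empty =>
    intro _ G _ _
    rw [Finset.coe_empty]
    exact (kPi_empty_le G).trans (Nat.one_le_iff_ne_zero.mpr (piPart_ne_zero _ _))
  | insert p s hp ih =>
    intro hs G _ _
    have hd : Disjoint ({p} : Set ℕ) (s : Set ℕ) := by
      rw [Set.disjoint_singleton_left]; exact_mod_cast hp
    rw [Finset.coe_insert, Set.insert_eq, piPart_union hd]
    refine (kPi_union_le hd (piPart (s : Set ℕ) (Nat.card G)) ?_).trans
      (Nat.mul_le_mul_right _ (kPi_prime_le (hs p (Finset.mem_insert_self p s))))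
    intro x _
    exact (ih (fun q hq => hs q (Finset.mem_insert_of_mem hq)) _).trans
      (piPart_le _ Nat.card_pos.ne' (Subgroup.card_subgroup_dvd_card _))

theorem kPi_le {G : Type*} [Group G] [Finite G] (σ : Set ℕ) :
    kPi σ G ≤ piPart σ (Nat.card G) := by
  have h : ∀ q : ℕ, q.Prime → q ∣ Nat.card G →
      (q ∈ σ ↔ q ∈ (((Nat.card G).primeFactors.filter (· ∈ σ) : Finset ℕ) : Set ℕ)) := by
    intro q hq hd
    simp [hq, hd, Nat.card_pos.ne']
  rw [kPi_congr h, piPart_congr h]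
  apply kPi_le_finset
  intro p hp
  exact Nat.prime_of_mem_primeFactors (Finset.mem_filter.mp hp).1

theorem kPi_union_le' {G : Type*} [Group G] [Finite G] {σ τ : Set ℕ} (hd : Disjoint σ τ) :
    kPi (σ ∪ τ) G ≤ kPi σ G * piPart τ (Nat.card G) := by
  apply kPi_union_le hd
  intro x _
  exact (kPi_le τ).trans (piPart_le _ Nat.card_pos.ne' (Subgroup.card_subgroup_dvd_card _))

/-! ### Normal complements with abelian quotient -/

/-- `N` is a normal `σ`-complement with abelian quotient. -/
def Good {G : Type*} [Group G] (σ : Set ℕ) (N : Subgroup G) : Prop :=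
  (∀ x y : G, x * y * x⁻¹ * y⁻¹ ∈ N) ∧ (∀ q : ℕ, q.Prime → q ∣ N.index → q ∈ σ) ∧
    (∀ q : ℕ, q.Prime → q ∣ Nat.card N → q ∉ σ)

theorem Good.normal {G : Type*} [Group G] {σ : Set ℕ} {N : Subgroup G} (h : Good σ N) :
    N.Normal := by
  constructor
  intro n hn g
  have := N.mul_mem (h.1 g n) hn
  simpa using this

theorem Good.subgroupOf {G : Type*} [Group G] [Finite G] {σ : Set ℕ} {N : Subgroup G}
    (h : Good σ N) (H : Subgroup G) : Good σ (N.subgroupOf H) := by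
  have := h.normal
  refine ⟨fun x y => ?_, fun q hq hd => ?_, fun q hq hd => ?_⟩
  · rw [Subgroup.mem_subgroupOf]
    exact h.1 x y
  · exact h.2.1 q hq (hd.trans (Subgroup.relIndex_dvd_index_of_normal N H))
  · refine h.2.2 q hq (hd.trans ?_)
    have h1 : Nat.card ((N.subgroupOf H).map H.subtype) = Nat.card (N.subgroupOf H) :=
      Subgroup.card_map_of_injective H.subtype_injective
    rw [← h1]
    apply Subgroup.card_dvd_of_le
    rintro _ ⟨x, hx, rfl⟩
    exact hx

theorem Good.inf {G : Type*} [Group G] [Finite G] {σ τ : Set ℕ} {N K : Subgroup G}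
    (h : Good σ N) (h' : Good τ K) : Good (σ ∪ τ) (N ⊓ K) := by
  have := h.normal
  refine ⟨fun x y => ⟨h.1 x y, h'.1 x y⟩, fun q hq hd => ?_, fun q hq hd => ?_⟩
  · rw [← Subgroup.relIndex_mul_index (inf_le_right : N ⊓ K ≤ K), Subgroup.inf_relIndex_right,
      hq.dvd_mul] at hd
    rcases hd with hd | hd
    · exact Or.inl (h.2.1 q hq (hd.trans (Subgroup.relIndex_dvd_index_of_normal N K)))
    · exact Or.inr (h'.2.1 q hq hd)
  · rintro (hs | hs)
    · exact h.2.2 q hq (hd.trans (Subgroup.card_dvd_of_le inf_le_left)) hs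
    · exact h'.2.2 q hq (hd.trans (Subgroup.card_dvd_of_le inf_le_right)) hs

theorem good_prime {G : Type*} [Group G] [Finite G] {p : ℕ} [hp : Fact p.Prime] (P : Sylow p G)
    (hP : Subgroup.normalizer ((P : Subgroup G) : Set G) ≤
        Subgroup.centralizer ((P : Subgroup G) : Set G)) :
    ∃ N : Subgroup G, Good {p} N := by
  have hc : ∀ a b : (P : Subgroup G), a * b = b * a := by
    intro a b
    apply Subtype.ext
    exact (Subgroup.mem_centralizer_iff.mp (hP (Subgroup.le_normalizer b.2)) a a.2)
  refine ⟨(MonoidHom.transferSylow P hP).ker, fun x y => ?_, fun q hq hd => ?_, fun q hq hd => ?_⟩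
  · rw [MonoidHom.mem_ker, map_mul, map_mul, map_mul, map_inv, map_inv, hc (MonoidHom.transferSylow P hP x) (MonoidHom.transferSylow P hP y)]
    group
  · have h1 := (MonoidHom.ker_transferSylow_isComplement' P hP).symm.index_eq_card
    rw [h1, P.card_eq_multiplicity] at hd
    exact (Nat.prime_dvd_prime_iff_eq hq hp.out).mp (hq.dvd_of_dvd_pow hd)
  · rintro rfl
    exact MonoidHom.not_dvd_card_ker_transferSylow P hP hd

theorem good_finset {G : Type*} [Group G] [Finite G] (s : Finset ℕ)
    (hs : ∀ p ∈ s, ∃ N : Subgroup G, Good {p} N) : ∃ N : Subgroup G, Good (s : Set ℕ) N := by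
  induction s using Finset.induction_on with
  | empty =>
    refine ⟨⊤, fun _ _ => Subgroup.mem_top _, fun q hq hd => ?_, fun q hq hd => by simp⟩
    rw [Subgroup.index_top] at hd
    exact absurd (Nat.dvd_one.mp hd) hq.ne_one
  | insert p s hp ih =>
    obtain ⟨N, hN⟩ := ih (fun q hq => hs q (Finset.mem_insert_of_mem hq))
    obtain ⟨K, hK⟩ := hs p (Finset.mem_insert_self p s)
    rw [Finset.coe_insert, Set.insert_eq]
    exact ⟨_, hK.inf hN⟩

theorem Good.congr {G : Type*} [Group G] [Finite G] {σ τ : Set ℕ} {N : Subgroup G} (h : Good σ N)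
    (hc : ∀ q : ℕ, q.Prime → q ∣ Nat.card G → (q ∈ σ ↔ q ∈ τ)) : Good τ N := by
  refine ⟨h.1, fun q hq hd => ?_, fun q hq hd => ?_⟩
  · exact (hc q hq (hd.trans (Subgroup.index_dvd_card N))).mp (h.2.1 q hq hd)
  · rw [← hc q hq (hd.trans (Subgroup.card_subgroup_dvd_card N))]
    exact h.2.2 q hq hd

theorem good_exists {G : Type*} [Group G] [Finite G] {σ : Set ℕ}
    (hs : ∀ p : ℕ, p.Prime → p ∣ Nat.card G → p ∈ σ → ∃ N : Subgroup G, Good {p} N) :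
    ∃ N : Subgroup G, Good σ N := by
  obtain ⟨N, hN⟩ := good_finset ((Nat.card G).primeFactors.filter (· ∈ σ)) (G := G) (by
    intro p hp
    rw [Finset.mem_filter] at hp
    exact hs p (Nat.prime_of_mem_primeFactors hp.1) (Nat.dvd_of_mem_primeFactors hp.1) hp.2)
  refine ⟨N, hN.congr ?_⟩
  intro q hq hd
  simp [hq, hd, Nat.card_pos.ne']

theorem Good.index {G : Type*} [Group G] [Finite G] {σ : Set ℕ} {N : Subgroup G} (h : Good σ N) :
    piPart σ (Nat.card G) = N.index := by
  rw [← Subgroup.index_mul_card N]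
  exact piPart_mul_left Subgroup.index_ne_zero_of_finite Nat.card_pos.ne' h.2.1 h.2.2

/-- The map from conjugacy classes to the abelian quotient. -/
def Good.toQ {G : Type*} [Group G] {σ : Set ℕ} {N : Subgroup G} (h : Good σ N) :
    ConjClasses G → G ⧸ N :=
  Quotient.lift (fun x : G => (x : G ⧸ N)) (by
    intro a b hab
    obtain ⟨g, rfl⟩ := isConj_iff.mp hab
    apply QuotientGroup.eq.mpr
    have := h.1 a⁻¹ g
    simpa [mul_assoc] using this)

theorem Good.toQ_mk {G : Type*} [Group G] {σ : Set ℕ} {N : Subgroup G} (h : Good σ N) (x : G) :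
    h.toQ (ConjClasses.mk x) = (x : G ⧸ N) := rfl

theorem Good.exists_pi {G : Type*} [Group G] [Finite G] {σ : Set ℕ} {N : Subgroup G}
    (h : Good σ N) (x : G) : ∃ e : ℕ, IsPiElement σ (x ^ e) ∧ ((x ^ e : G) : G ⧸ N) = x := by
  obtain ⟨e, f, hef⟩ := exists_exponents G σ
  refine ⟨e, (hef x).2.2.1, ?_⟩
  apply QuotientGroup.eq.mpr
  have h1 : (x ^ e)⁻¹ * x = x ^ f := by
    rw [inv_mul_eq_iff_eq_mul]; exact (hef x).2.2.2.2.symm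
  rw [h1]
  have h2 := (hef x).2.2.2.1
  have := h.normal
  rw [← QuotientGroup.eq_one_iff, ← orderOf_eq_one_iff]
  by_contra hne
  obtain ⟨q, hq, hd⟩ := Nat.exists_prime_and_dvd hne
  have h3 : q ∣ N.index := hd.trans (orderOf_dvd_natCard _)
  have h4 : q ∣ orderOf (x ^ f) := hd.trans (orderOf_map_dvd (QuotientGroup.mk' N) (x ^ f))
  exact h2 q hq h4 (h.2.1 q hq h3)

theorem Good.bijective {G : Type*} [Group G] [Finite G] {σ : Set ℕ} {N : Subgroup G}
    (h : Good σ N) : Function.Bijective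
      (fun c : {c : ConjClasses G | ∃ x : G, ConjClasses.mk x = c ∧ IsPiElement σ x} =>
        h.toQ c.1) := by
  have hs : Function.Surjective
      (fun c : {c : ConjClasses G | ∃ x : G, ConjClasses.mk x = c ∧ IsPiElement σ x} =>
        h.toQ c.1) := by
    intro a
    induction a using QuotientGroup.induction_on with | _ x
    obtain ⟨e, h1, h2⟩ := h.exists_pi x
    exact ⟨⟨ConjClasses.mk (x ^ e), x ^ e, rfl, h1⟩, h2⟩
  rw [Nat.bijective_iff_surjective_and_card]
  refine ⟨hs, le_antisymm ?_ (Nat.card_le_card_of_surjective _ hs)⟩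
  have := kPi_le (G := G) σ
  rw [h.index] at this
  exact this

theorem Good.kPi_eq {G : Type*} [Group G] [Finite G] {σ : Set ℕ} {N : Subgroup G}
    (h : Good σ N) : kPi σ G = piPart σ (Nat.card G) := by
  rw [h.index]
  exact Nat.card_eq_of_bijective _ h.bijective

theorem Good.isConj {G : Type*} [Group G] [Finite G] {σ : Set ℕ} {N : Subgroup G}
    (h : Good σ N) {x y : G} (hx : IsPiElement σ x) (hy : IsPiElement σ y)
    (hxy : (x : G ⧸ N) = y) : IsConj x y := by
  have := @(h.bijective).1 ⟨ConjClasses.mk x, x, rfl, hx⟩ ⟨ConjClasses.mk y, y, rfl, hy⟩ hxy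
  exact ConjClasses.mk_eq_mk_iff_isConj.mp (congrArg Subtype.val this)


/-! ### The exceptional prime -/

theorem local_bound {G : Type*} [Group G] [Finite G] {p : ℕ} [hp : Fact p.Prime] (P : Sylow p G)
    (y : G) (hy : ∀ z : G, z ∈ Subgroup.centralizer ((P : Subgroup G) : Set G) → ¬ IsConj z y) :
    p * kPi {p} (Subgroup.centralizer {y}) ≤ Nat.card (P : Subgroup G) := by
  refine (Nat.mul_le_mul_left p (kPi_le _)).trans ?_
  have hd := piPart_dvd_piPart {p} (Nat.card_pos (α := G)).ne'
    (Subgroup.card_subgroup_dvd_card (Subgroup.centralizer {y}))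
  have hP : piPart {p} (Nat.card G) = Nat.card (P : Subgroup G) := piPart_sylow P
  have hne : piPart {p} (Nat.card (Subgroup.centralizer {y})) ≠ piPart {p} (Nat.card G) := by
    intro he
    obtain ⟨Q⟩ : Nonempty (Sylow p (Subgroup.centralizer {y})) := inferInstance
    have hQ : piPart {p} (Nat.card (Subgroup.centralizer {y})) =
      Nat.card (Q : Subgroup (Subgroup.centralizer {y})) := piPart_sylow Q
    set M := (Q : Subgroup (Subgroup.centralizer {y})).map (Subgroup.centralizer {y}).subtype
      with hM
    have hMc : Nat.card M = Nat.card (P : Subgroup G) := by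
      rw [← hP, ← he, hQ]
      exact Subgroup.card_map_of_injective (Subgroup.subtype_injective _)
    have hMp : IsPGroup p M := by
      obtain ⟨n, hn⟩ := P.isPGroup'.exists_card_eq
      exact IsPGroup.of_card (hMc.trans hn)
    obtain ⟨R, hR⟩ := hMp.exists_le_sylow
    obtain ⟨g, hg⟩ := MulAction.exists_smul_eq G P R
    have hRc : Nat.card (R : Subgroup G) = Nat.card (P : Subgroup G) := by
      rw [← hP]; exact (piPart_sylow R).symm
    have hMR : M = R := Subgroup.eq_of_le_of_card_ge hR (by rw [hRc, hMc])
    apply hy (g⁻¹ * y * g)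
    · rw [Subgroup.mem_centralizer_iff]
      intro x hx
      have h1 : g * x * g⁻¹ ∈ M := by
        rw [hMR, ← hg]
        exact Subgroup.smul_mem_pointwise_smul x (MulAut.conj g) (P : Subgroup G) hx
      obtain ⟨z, -, hz⟩ := h1
      have h2 := Subgroup.mem_centralizer_singleton_iff.mp z.2
      have hz' : (z : G) = g * x * g⁻¹ := hz
      rw [hz'] at h2
      have h3 : y * (g * x * g⁻¹) = (g * x * g⁻¹) * y := by
        first | exact h2 | exact h2.symm
      calc x * (g⁻¹ * y * g) = g⁻¹ * ((g * x * g⁻¹) * y) * g := by group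
        _ = g⁻¹ * (y * (g * x * g⁻¹)) * g := by rw [h3]
        _ = g⁻¹ * y * g * x := by group
    · rw [isConj_iff]
      exact ⟨g, by group⟩
  rw [hP] at hd hne
  obtain ⟨n, hn⟩ := P.isPGroup'.exists_card_eq
  have hn' : Nat.card (P : Subgroup G) = p ^ n := hn
  rw [hn'] at hd hne ⊢
  obtain ⟨k, hk, hk'⟩ := (Nat.dvd_prime_pow hp.out).mp hd
  rw [hk'] at hne ⊢
  have hkn : k < n := lt_of_le_of_ne hk (fun h => hne (by rw [h]))
  rw [← pow_succ']
  exact Nat.pow_le_pow_right hp.out.pos hkn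

theorem local_exact {G : Type*} [Group G] [Finite G] [hp : Fact (Nat.Prime 3)] (P : Sylow 3 G)
    (hk : 3 * kPi {3} G = 2 * Nat.card (P : Subgroup G))
    (hP : ¬ Subgroup.normalizer ((P : Subgroup G) : Set G) ≤
        Subgroup.centralizer ((P : Subgroup G) : Set G))
    {σ : Set ℕ} {N : Subgroup G} (hN : Good σ N) {y : G} (hy : IsPiElement σ y)
    (hyP : y ∈ Subgroup.centralizer ((P : Subgroup G) : Set G)) :
    3 * kPi {3} (Subgroup.centralizer {y}) = 2 * Nat.card (P : Subgroup G) := by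
  have hle : (P : Subgroup G) ≤ Subgroup.centralizer {y} := by
    intro x hx
    rw [Subgroup.mem_centralizer_iff] at hyP ⊢
    intro z hz
    rw [Set.mem_singleton_iff.mp hz]
    exact (hyP x hx).symm
  have hk1 : kPi {3} G ≤ kPi {3} (Subgroup.centralizer {y}) := by
    apply kPi_le_of_hom (Subgroup.centralizer {y}).subtype
    intro x hx
    obtain ⟨z, hz, hc⟩ := exists_conj_mem_sylow P hx
    exact ⟨⟨z, hle hz⟩, isPiElement_coe.mp (isPi_of_mem_sylow P hz), hc⟩
  have hpos : 0 < Nat.card (P : Subgroup G) := Nat.card_pos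
  have hcard : Nat.card ((P.subtype hle : Sylow 3 (Subgroup.centralizer {y})) :
      Subgroup (Subgroup.centralizer {y})) = Nat.card (P : Subgroup G) := by
    rw [Sylow.coe_subtype]
    exact Nat.card_congr (Subgroup.subgroupOfEquivOfLe hle).toEquiv
  obtain ⟨-, ⟨h1, -⟩ | ⟨-, h1, -⟩⟩ := single_prime (P.subtype hle) (by
    change 5 * Nat.card ((P.subtype hle : Sylow 3 (Subgroup.centralizer {y})) :
      Subgroup (Subgroup.centralizer {y})) < _
    rw [hcard]; omega)
  · exfalso
    apply hP
    intro g hg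
    have hg1 : ∀ x : G, x ∈ (P : Subgroup G) ↔ g * x * g⁻¹ ∈ (P : Subgroup G) := by
      intro x; exact Subgroup.mem_normalizer_iff.mp hg x
    have hy' : g * y * g⁻¹ ∈ Subgroup.centralizer ((P : Subgroup G) : Set G) := by
      rw [Subgroup.mem_centralizer_iff] at hyP ⊢
      intro x hx
      have h2 : g⁻¹ * x * g ∈ (P : Subgroup G) := by
        rw [hg1]
        have e2 : g * (g⁻¹ * x * g) * g⁻¹ = x := by group
        rw [e2]; exact hx
      have h3 := hyP _ h2
      calc x * (g * y * g⁻¹) = g * ((g⁻¹ * x * g) * y) * g⁻¹ := by group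
        _ = g * (y * (g⁻¹ * x * g)) * g⁻¹ := by rw [h3]
        _ = g * y * g⁻¹ * x := by group
    have hconj := (hN.subgroupOf (Subgroup.centralizer ((P : Subgroup G) : Set G))).isConj
      (x := ⟨y, hyP⟩) (y := ⟨g * y * g⁻¹, hy'⟩) (isPiElement_coe.mp hy)
      (isPiElement_coe.mp ((isPiElement_conj_iff (isConj_iff.mpr ⟨g, rfl⟩)).mp hy)) (by
        apply QuotientGroup.eq.mpr
        rw [Subgroup.mem_subgroupOf]
        have := hN.1 y⁻¹ g
        simpa [mul_assoc] using this)
    obtain ⟨c, hc⟩ := isConj_iff.mp hconj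
    have hc1 : (c : G) * y * (c : G)⁻¹ = g * y * g⁻¹ := congrArg Subtype.val hc
    have hc2 := Subgroup.mem_centralizer_iff.mp c.2
    have hH : (c : G)⁻¹ * g ∈ Subgroup.centralizer {y} := by
      rw [Subgroup.mem_centralizer_iff]
      intro z hz
      rw [Set.mem_singleton_iff.mp hz]
      calc y * ((c : G)⁻¹ * g) = (c : G)⁻¹ * ((c : G) * y * (c : G)⁻¹) * g := by group
        _ = (c : G)⁻¹ * (g * y * g⁻¹) * g := by rw [hc1]
        _ = (c : G)⁻¹ * g * y := by group
    have hnorm : ∀ x : G, x ∈ (P : Subgroup G) ↔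
        ((c : G)⁻¹ * g) * x * ((c : G)⁻¹ * g)⁻¹ ∈ (P : Subgroup G) := by
      intro x
      have e1 : ((c : G)⁻¹ * g) * x * ((c : G)⁻¹ * g)⁻¹ = (c : G)⁻¹ * (g * x * g⁻¹) * c := by group
      have hcc : ∀ w : G, w ∈ (P : Subgroup G) ↔ (c : G)⁻¹ * w * c ∈ (P : Subgroup G) := by
        intro w
        constructor
        · intro hw
          rw [mul_assoc, hc2 w hw, inv_mul_cancel_left]; exact hw
        · intro hw
          have h5 := hc2 _ hw
          have h6 : (c : G)⁻¹ * w * c = w := by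
            have : (c : G)⁻¹ * w * c * c = w * c := by rw [h5]; group
            exact mul_right_cancel this
          rw [← h6]; exact hw
      rw [e1, ← hcc, ← hg1]
    have hin := h1 (x := ⟨(c : G)⁻¹ * g, hH⟩) (by
      rw [Subgroup.mem_normalizer_iff]
      intro x
      exact hnorm x)
    rw [Subgroup.mem_centralizer_iff] at hin ⊢
    intro x hx
    have h7 : x * ((c : G)⁻¹ * g) = (c : G)⁻¹ * g * x :=
      congrArg Subtype.val (hin ⟨x, hle hx⟩ hx)
    have h8 := hc2 x hx
    calc x * g = (x * c) * ((c : G)⁻¹ * g) := by group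
      _ = c * (x * ((c : G)⁻¹ * g)) := by rw [h8, mul_assoc]
      _ = c * ((c : G)⁻¹ * g * x) := by rw [h7]
      _ = g * x := by group
  · rw [h1, ← hcard]

theorem kPi_exceptional {G : Type*} [Group G] [Finite G] [hp : Fact (Nat.Prime 3)] (P : Sylow 3 G)
    (hk : 3 * kPi {3} G = 2 * Nat.card (P : Subgroup G))
    (hP : ¬ Subgroup.normalizer ((P : Subgroup G) : Set G) ≤
        Subgroup.centralizer ((P : Subgroup G) : Set G))
    {σ : Set ℕ} (hd : Disjoint σ {3}) {N : Subgroup G} (hN : Good σ N) :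
    3 * kPi (σ ∪ {3}) G = 2 * piPart (σ ∪ {3}) (Nat.card G) ∨
      2 * kPi (σ ∪ {3}) G ≤ piPart (σ ∪ {3}) (Nat.card G) := by
  have : Fintype G := Fintype.ofFinite G
  have hQ : piPart {3} (Nat.card G) = Nat.card (P : Subgroup G) := piPart_sylow P
  have hNn := hN.normal
  have hout : ∀ c : ConjClasses G, ConjClasses.mk (Quotient.out c) = c := fun c => Quotient.out_eq c
  rw [piPart_union hd, hQ, ← hN.kPi_eq, kPi_union hd]
  by_cases hW : (Subgroup.centralizer ((P : Subgroup G) : Set G)).map (QuotientGroup.mk' N) = ⊤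
  · left
    rw [kPi_eq_sum, Finset.mul_sum, Finset.sum_mul, Finset.mul_sum]
    apply Finset.sum_congr rfl
    intro c _
    split_ifs with hc
    · rw [one_mul]
      have hx : IsPiElement σ (Quotient.out c) := by
        rw [← piClass_mk, hout]; exact hc
      have h1 : ((Quotient.out c : G) : G ⧸ N) ∈
        (Subgroup.centralizer ((P : Subgroup G) : Set G)).map (QuotientGroup.mk' N) :=
        hW ▸ Subgroup.mem_top _
      obtain ⟨z, hz, hz'⟩ := h1
      obtain ⟨e, he, he'⟩ := hN.exists_pi z
      have hcj := hN.isConj he hx (he'.trans hz')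
      rw [← kPi_centralizer_eq hcj]
      exact local_exact P hk hP hN he (Subgroup.pow_mem _ hz e)
    · simp
  · right
    set W := (Subgroup.centralizer ((P : Subgroup G) : Set G)).map (QuotientGroup.mk' N) with hWd
    set T := Finset.univ.filter (fun c : ConjClasses G =>
      ∃ y ∈ Subgroup.centralizer ((P : Subgroup G) : Set G), IsPiElement σ y ∧
        ConjClasses.mk y = c) with hT
    have hTW : T.card ≤ Nat.card W := by
      have hinj : Function.Injective (fun c : T => (⟨hN.toQ c.1, by
          obtain ⟨c, hc⟩ := c
          obtain ⟨-, y, hy, -, rfl⟩ := Finset.mem_filter.mp hc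
          exact ⟨y, hy, rfl⟩⟩ : W)) := by
        rintro ⟨a, ha⟩ ⟨b, hb⟩ hab
        obtain ⟨-, x, hx, hx', rfl⟩ := Finset.mem_filter.mp ha
        obtain ⟨-, y, hy, hy', rfl⟩ := Finset.mem_filter.mp hb
        have h1 : (x : G ⧸ N) = y := congrArg Subtype.val hab
        apply Subtype.ext
        exact ConjClasses.mk_eq_mk_iff_isConj.mpr (hN.isConj hx' hy' h1)
      have := Nat.card_le_card_of_injective _ hinj
      simpa using this
    have hW2 : 2 * Nat.card W ≤ kPi σ G := by
      rw [hN.kPi_eq, hN.index]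
      change _ ≤ Nat.card (G ⧸ N)
      rw [← Subgroup.index_mul_card W]
      apply Nat.mul_le_mul_right
      have h0 : W.index ≠ 0 := Subgroup.index_ne_zero_of_finite
      have h1 : W.index ≠ 1 := fun h => hW (Subgroup.index_eq_one.mp h)
      omega
    have hsum : 3 * (∑ c : ConjClasses G,
      if (∃ y : G, ConjClasses.mk y = c ∧ IsPiElement σ y) then
        kPi {3} (Subgroup.centralizer {Quotient.out c}) else 0) ≤
        kPi σ G * Nat.card (P : Subgroup G) + T.card * Nat.card (P : Subgroup G) := by
      rw [kPi_eq_sum, Finset.mul_sum, Finset.sum_mul, hT, Finset.card_filter, Finset.sum_mul,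
        ← Finset.sum_add_distrib]
      apply Finset.sum_le_sum
      intro c _
      by_cases hc : ∃ y : G, ConjClasses.mk y = c ∧ IsPiElement σ y
      · rw [if_pos hc, if_pos hc]
        have hx : IsPiElement σ (Quotient.out c) := by
          rw [← piClass_mk, hout]; exact hc
        by_cases hb : ∃ y ∈ Subgroup.centralizer ((P : Subgroup G) : Set G), IsPiElement σ y ∧
            ConjClasses.mk y = c
        · rw [if_pos hb]
          obtain ⟨y, hy, hys, hyc⟩ := hb
          rw [← hout c, ConjClasses.mk_eq_mk_iff_isConj] at hyc
          rw [← kPi_centralizer_eq hyc, local_exact P hk hP hN hys hy]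
          omega
        · rw [if_neg hb]
          have := local_bound P (Quotient.out c) (by
            intro z hz hzc
            apply hb
            exact ⟨z, hz, (isPiElement_conj_iff hzc).mpr hx,
              (ConjClasses.mk_eq_mk_iff_isConj.mpr hzc).trans (hout c)⟩)
          omega
      · rw [if_neg hc]; simp
    have h9 : 2 * T.card ≤ kPi σ G := by omega
    have h10 := Nat.mul_le_mul_right (Nat.card (P : Subgroup G)) h9
    nlinarith

theorem main_nat {G : Type*} [Group G] [Finite G] (π : Set ℕ)
    (hπ : ∀ p ∈ π, Nat.Prime p) (h : 5 * piPart π (Nat.card G) < 8 * kPi π G) :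
    kPi π G = piPart π (Nat.card G) ∨ 3 * kPi π G = 2 * piPart π (Nat.card G) := by
  have hprime : ∀ p ∈ π, 5 * piPart {p} (Nat.card G) < 8 * kPi {p} G := by
    intro p hp
    have hd : Disjoint ({p} : Set ℕ) (π \ {p}) := Set.disjoint_sdiff_right
    have hu : ({p} : Set ℕ) ∪ (π \ {p}) = π :=
      Set.union_sdiff_cancel (Set.singleton_subset_iff.mpr hp)
    have h1 := kPi_union_le' (G := G) hd
    have h2 := piPart_union hd (Nat.card G)
    rw [hu] at h1 h2
    rw [h2] at h
    have h3 : 5 * piPart {p} (Nat.card G) * piPart (π \ {p}) (Nat.card G) <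
        8 * kPi {p} G * piPart (π \ {p}) (Nat.card G) := by nlinarith
    exact lt_of_mul_lt_mul_right h3 (Nat.zero_le _)
  have hsingle : ∀ p ∈ π, ¬ (∃ N : Subgroup G, Good {p} N) → p = 3 := by
    intro p hp hno
    have : Fact p.Prime := ⟨hπ p hp⟩
    obtain ⟨P⟩ : Nonempty (Sylow p G) := inferInstance
    have h1 := hprime p hp
    rw [piPart_sylow P] at h1
    rcases (single_prime P h1).2 with ⟨h2, -⟩ | ⟨h2, -⟩
    · exact absurd (good_prime P h2) hno
    · exact h2
  by_cases hall : ∀ p ∈ π, ∃ N : Subgroup G, Good {p} N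
  · left
    obtain ⟨N, hN⟩ := good_exists (G := G) (σ := π) (fun p _ _ hp => hall p hp)
    exact hN.kPi_eq
  · push Not at hall
    obtain ⟨p, hp, hno⟩ := hall
    have hno' : ¬ ∃ N : Subgroup G, Good {p} N := fun ⟨N, hN⟩ => hno N hN
    obtain rfl := hsingle p hp hno'
    obtain ⟨N, hN⟩ := good_exists (G := G) (σ := π \ {3}) (fun q _ _ hq => by
      by_contra hq'
      exact hq.2 (hsingle q hq.1 hq'))
    have : Fact (Nat.Prime 3) := ⟨Nat.prime_three⟩
    obtain ⟨P⟩ : Nonempty (Sylow 3 G) := inferInstance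
    have h1 := hprime 3 hp
    rw [piPart_sylow P] at h1
    rcases (single_prime P h1).2 with ⟨h2, -⟩ | ⟨-, h2, h3⟩
    · exact absurd (good_prime P h2) hno'
    · have hd : Disjoint (π \ {3}) ({3} : Set ℕ) := Set.disjoint_sdiff_left
      have hu : (π \ {3}) ∪ ({3} : Set ℕ) = π :=
        Set.sdiff_union_of_subset (Set.singleton_subset_iff.mpr hp)
      have h4 := kPi_exceptional P h2 h3 hd hN
      rw [hu] at h4
      rcases h4 with h4 | h4
      · exact Or.inr h4
      · omega


/-- If `d_π(G) > 5/8` then `d_π(G) = 1` or `d_π(G) = 2/3`. -/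
theorem dPi_eq_one_or_two_thirds_of_five_eighths_lt_dPi
    {G : Type*} [Group G] [Finite G] (π : Set ℕ)
    (hπ : ∀ p ∈ π, Nat.Prime p) (h : 5 / 8 < dPi π G) :
    dPi π G = 1 ∨ dPi π G = 2 / 3 := by
  have hpos : (0 : ℚ) < (piPart π (Nat.card G) : ℚ) := by
    exact_mod_cast Nat.pos_of_ne_zero (piPart_ne_zero π (Nat.card G))
  unfold dPi at h ⊢
  rw [lt_div_iff₀ hpos] at h
  have h1 : 5 * piPart π (Nat.card G) < 8 * kPi π G := by
    have : (5 : ℚ) * (piPart π (Nat.card G) : ℚ) < 8 * (kPi π G : ℚ) := by linarith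
    exact_mod_cast this
  rcases main_nat π hπ h1 with h2 | h2
  · left
    rw [h2, div_self hpos.ne']
  · right
    rw [div_eq_div_iff hpos.ne' (by norm_num)]
    have : (3 : ℚ) * (kPi π G : ℚ) = 2 * (piPart π (Nat.card G) : ℚ) := by exact_mod_cast h2
    linarith
end

section
/- Let G be a finite group and let π = {p_1, ..., p_t} be a set of primes, each dividing |G|. Then for each i with 1 ≤ i ≤ t there exists a p_i-subgroup Q_i of G such that k_π(G) ≤ ∏_{i=1}^{t} k(Q_i), where k(Q_i) is the number of conjugacy classes of Q_i. -/
open scoped Classical Pointwise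

theorem card_conjClasses_le_of_mulEquiv {H K : Type*} [Group H] [Group K] [Finite H]
    (e : H ≃* K) : Nat.card (ConjClasses K) ≤ Nat.card (ConjClasses H) := by
  have : Finite (ConjClasses H) := Quotient.finite _
  exact Nat.card_le_card_of_surjective (ConjClasses.map e.toMonoidHom)
    (ConjClasses.map_surjective e.surjective)

/-- Splitting off the `p`-part of an element. -/
theorem exists_p_part {G : Type*} [Group G] [Finite G] {p : ℕ} (hp : p.Prime) (s : Set ℕ)
    (x : G) (hx : IsPiElement (insert p s) x) :
    ∃ u v : G, Commute u v ∧ x = u * v ∧ IsPiElement {p} u ∧ IsPiElement s v := by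
  have hn : orderOf x ≠ 0 := (orderOf_pos x).ne'
  obtain ⟨k, m, hm, hnk⟩ := Nat.exists_eq_pow_mul_and_not_dvd hn p hp.ne_one
  have hcop : IsCoprime ((p ^ k : ℕ) : ℤ) (m : ℤ) :=
    Nat.isCoprime_iff_coprime.2 (((hp.coprime_iff_not_dvd).2 hm).pow_left k)
  obtain ⟨a, b, hab⟩ := hcop
  have key : ∀ z : ℤ, x ^ (z * (m : ℤ) * ((p ^ k : ℕ) : ℤ)) = 1 := fun z => by
    apply orderOf_dvd_iff_zpow_eq_one.1
    rw [hnk]; exact ⟨z, by push_cast; ring⟩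
  refine ⟨x ^ (b * (m : ℤ)), x ^ (a * ((p ^ k : ℕ) : ℤ)), ?_, ?_, ?_, ?_⟩
  · exact (Commute.refl x).zpow_zpow _ _
  · rw [← zpow_add, add_comm, hab, zpow_one]
  · intro q hq hqd
    have h1 : (x ^ (b * (m : ℤ))) ^ (p ^ k) = 1 := by
      rw [← zpow_natCast, ← zpow_mul]; exact key b
    exact (Nat.prime_dvd_prime_iff_eq hq hp).1
      (hq.dvd_of_dvd_pow (hqd.trans (orderOf_dvd_of_pow_eq_one h1)))
  · intro q hq hqd
    have h1 : (x ^ (a * ((p ^ k : ℕ) : ℤ))) ^ m = 1 := by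
      rw [← zpow_natCast, ← zpow_mul]
      rw [show a * ((p ^ k : ℕ) : ℤ) * (m : ℤ) = a * m * ((p ^ k : ℕ) : ℤ) by ring]
      exact key a
    have hqm : q ∣ m := hqd.trans (orderOf_dvd_of_pow_eq_one h1)
    rcases hx q hq (hnk ▸ hqm.mul_left _) with h | h
    · exact absurd (h ▸ hqm) hm
    · exact h

theorem IsPiElement.conj {G : Type*} [Group G] {s : Set ℕ} {x : G} (h : IsPiElement s x)
    (g : G) : IsPiElement s (g * x * g⁻¹) := by
  intro q hq hqd
  refine h q hq ?_
  have : orderOf (g * x * g⁻¹) = orderOf x :=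
    orderOf_injective (MulAut.conj g).toMonoidHom (MulAut.conj g).injective x
  rwa [this] at hqd

theorem kPi_singleton_le {G : Type*} [Group G] [Finite G] {p : ℕ} (hp : p.Prime)
    (P : Sylow p G) : kPi {p} G ≤ Nat.card (ConjClasses P) := by
  have := Fact.mk hp
  have : Finite (ConjClasses P) := Quotient.finite _
  have : Finite (ConjClasses G) := Quotient.finite _
  have hsub : {c : ConjClasses G | ∃ x : G, ConjClasses.mk x = c ∧ IsPiElement {p} x} ⊆
      Set.range (ConjClasses.map (P : Subgroup G).subtype) := by
    rintro c ⟨x, rfl, hx⟩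
    have hpx : IsPGroup p (Subgroup.zpowers x) := by
      have hord : orderOf x = p ^ (orderOf x).primeFactorsList.length :=
        Nat.eq_prime_pow_of_unique_prime_dvd (orderOf_pos x).ne' (fun {q} hq hd => hx q hq hd)
      exact IsPGroup.of_card (n := (orderOf x).primeFactorsList.length)
        (by rw [Nat.card_zpowers]; exact hord)
    obtain ⟨R, hR⟩ := hpx.exists_le_sylow
    obtain ⟨g, hg⟩ := MulAction.exists_smul_eq G R P
    have hmem : g * x * g⁻¹ ∈ P := by
      rw [← hg]
      exact Subgroup.smul_mem_pointwise_smul x (MulAut.conj g) (R : Subgroup G)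
        (hR (Subgroup.mem_zpowers x))
    refine ⟨ConjClasses.mk ⟨g * x * g⁻¹, hmem⟩, ?_⟩
    change ConjClasses.mk (g * x * g⁻¹) = _
    exact ConjClasses.mk_eq_mk_iff_isConj.2 (isConj_iff.2 ⟨g, rfl⟩).symm
  exact (Nat.card_mono (Set.toFinite _) hsub).trans
    (Nat.card_le_card_of_surjective _ Set.rangeFactorization_surjective)

theorem kPi_insert_le {G : Type*} [Group G] [Finite G] {p : ℕ} (hp : p.Prime) (s : Set ℕ) :
    ∃ z : G, kPi (insert p s) G ≤ kPi {p} G * kPi s (Subgroup.centralizer {z}) := by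
  have : Finite (ConjClasses G) := Quotient.finite _
  have hfin : ∀ z : G, Finite (ConjClasses (Subgroup.centralizer {z})) :=
    fun z => Quotient.finite _
  have hout : ∀ (H : Type _) [Group H] (c : ConjClasses H), ∃ x : H, ConjClasses.mk x = c :=
    fun H _ c => ConjClasses.exists_rep c
  obtain ⟨z, hz⟩ := Finite.exists_max (fun z : G => kPi s (Subgroup.centralizer {z}))
  refine ⟨z, ?_⟩
  choose r hr using hout G
  choose o ho using fun z : G => hout (Subgroup.centralizer {z})
  let D := {c : ConjClasses G | ∃ x : G, ConjClasses.mk x = c ∧ IsPiElement {p} x}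
  let E : D → Type _ := fun d =>
    {c : ConjClasses (Subgroup.centralizer {r d.1}) |
      ∃ x, ConjClasses.mk x = c ∧ IsPiElement s x}
  have hE : ∀ d, Finite (E d) := fun d => by dsimp only [E]; infer_instance
  let f : (Σ d : D, E d) → ConjClasses G := fun de =>
    ConjClasses.mk (r de.1.1 * (o (r de.1.1) de.2.1 : G))
  have hsub : {c : ConjClasses G | ∃ x : G, ConjClasses.mk x = c ∧
      IsPiElement (insert p s) x} ⊆ Set.range f := by
    rintro c ⟨x, rfl, hx⟩
    obtain ⟨u, v, huv, rfl, hu, hv⟩ := exists_p_part hp s x hx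
    obtain ⟨g, hg⟩ := isConj_iff.1 (ConjClasses.mk_eq_mk_iff_isConj.1 (hr (ConjClasses.mk u)).symm)
    have hy : g * v * g⁻¹ ∈ Subgroup.centralizer {r (ConjClasses.mk u)} := by
      rw [Subgroup.mem_centralizer_singleton_iff, ← hg]
      have := huv.eq
      simp only [mul_assoc, inv_mul_cancel_left]
      rw [← mul_assoc v u, ← mul_assoc u v, this]
    let y : Subgroup.centralizer {r (ConjClasses.mk u)} := ⟨g * v * g⁻¹, hy⟩
    have hyp : IsPiElement s y := by
      intro q hq hqd
      rw [← Subgroup.orderOf_coe] at hqd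
      exact hv.conj g q hq hqd
    refine ⟨⟨⟨ConjClasses.mk u, u, rfl, hu⟩, ⟨ConjClasses.mk y, y, rfl, hyp⟩⟩, ?_⟩
    change ConjClasses.mk (r (ConjClasses.mk u) * (o (r (ConjClasses.mk u)) (ConjClasses.mk y) : G))
      = _
    obtain ⟨w, hw⟩ := isConj_iff.1 (ConjClasses.mk_eq_mk_iff_isConj.1
      (ho (r (ConjClasses.mk u)) (ConjClasses.mk y)))
    have hw' : (w : G) * (o (r (ConjClasses.mk u)) (ConjClasses.mk y) : G) * (w : G)⁻¹
      = g * v * g⁻¹ := congrArg Subtype.val hw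
    have hwc := Subgroup.mem_centralizer_singleton_iff.1 w.2
    refine ConjClasses.mk_eq_mk_iff_isConj.2 (isConj_iff.2 ⟨g⁻¹ * w, ?_⟩)
    have e1 : (w : G) * (r (ConjClasses.mk u) * (o (r (ConjClasses.mk u)) (ConjClasses.mk y) : G))
        * (w : G)⁻¹ = g * (u * v) * g⁻¹ := by
      rw [← mul_assoc, hwc, mul_assoc, mul_assoc, ← mul_assoc (w : G), hw', ← hg]
      group
    calc _ = g⁻¹ * ((w : G) * (r (ConjClasses.mk u) *
            (o (r (ConjClasses.mk u)) (ConjClasses.mk y) : G)) * (w : G)⁻¹) * g := by group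
      _ = u * v := by rw [e1]; group
  have := Fintype.ofFinite D
  calc kPi (insert p s) G ≤ Nat.card (Set.range f) := Nat.card_mono (Set.toFinite _) hsub
    _ ≤ Nat.card (Σ d : D, E d) :=
      Nat.card_le_card_of_surjective _ Set.rangeFactorization_surjective
    _ = ∑ d : D, Nat.card (E d) := Nat.card_sigma
    _ ≤ ∑ d : D, kPi s (Subgroup.centralizer {z}) := Finset.sum_le_sum fun d _ => hz (r d.1)
    _ = _ := by
      rw [Finset.sum_const, smul_eq_mul, Finset.card_univ, ← Nat.card_eq_fintype_card]; rfl

theorem kPi_finset_le (s : Finset ℕ) : (∀ q ∈ s, q.Prime) →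
    ∀ (G : Type*) [Group G] [Finite G], ∃ Q : ℕ → Subgroup G, (∀ q ∈ s, IsPGroup q (Q q)) ∧
      kPi (s : Set ℕ) G ≤ ∏ q ∈ s, Nat.card (ConjClasses (Q q)) := by
  induction s using Finset.induction_on with
  | empty =>
    intro _ G _ _
    refine ⟨fun _ => ⊥, by simp, ?_⟩
    rw [Finset.prod_empty]
    refine Finite.card_le_one_iff_subsingleton |>.2 ⟨?_⟩
    have h1 : ∀ x : G, IsPiElement ((∅ : Finset ℕ) : Set ℕ) x → x = 1 := by
      intro x hx
      by_contra hne
      obtain ⟨q, hq, hd⟩ := Nat.exists_prime_and_dvd (fun h => hne (orderOf_eq_one_iff.1 h))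
      simpa using hx q hq hd
    rintro ⟨_, x, rfl, hx⟩ ⟨_, y, rfl, hy⟩
    rw [Subtype.mk.injEq, h1 x hx, h1 y hy]
  | insert p s hps ih =>
    intro hs G _ _
    have hp : p.Prime := hs p (Finset.mem_insert_self _ _)
    have := Fact.mk hp
    obtain ⟨z, hz⟩ := kPi_insert_le (G := G) hp (s : Set ℕ)
    obtain ⟨Q, hQ, hle⟩ := ih (fun q hq => hs q (Finset.mem_insert_of_mem hq))
      (Subgroup.centralizer {z})
    obtain ⟨P⟩ : Nonempty (Sylow p G) := inferInstance
    have hne : ∀ q ∈ s, q ≠ p := fun q hq h => hps (h ▸ hq)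
    obtain ⟨R, hRp, hRq⟩ : ∃ R : ℕ → Subgroup G, R p = (P : Subgroup G) ∧
        ∀ q, q ≠ p → R q = (Q q).map (Subgroup.centralizer {z}).subtype :=
      ⟨fun q => if q = p then (P : Subgroup G) else
        (Q q).map (Subgroup.centralizer {z}).subtype, if_pos rfl, fun q hq => if_neg hq⟩
    refine ⟨R, ?_, ?_⟩
    · intro q hq
      by_cases h : q = p
      · rw [h, hRp]; exact P.isPGroup'
      · rw [hRq q h]
        exact (hQ q ((Finset.mem_insert.1 hq).resolve_left h)).map _
    · rw [Finset.coe_insert, Finset.prod_insert hps]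
      refine hz.trans (Nat.mul_le_mul ?_ (hle.trans (Finset.prod_le_prod' fun q hq => ?_)))
      · rw [hRp]; exact kPi_singleton_le hp P
      · rw [hRq q (hne q hq)]
        exact card_conjClasses_le_of_mulEquiv
          ((Q q).equivMapOfInjective _ (Subgroup.subtype_injective _)).symm

/-- Robinson: if `π = {p 0, …, p (t-1)}` consists of primes dividing `|G|`,
then there are `p i`-subgroups `Q i` of `G` with
`k_π(G) ≤ ∏ i, k(Q i)`. -/
theorem kPi_le_prod_card_conjClasses
    {G : Type*} [Group G] [Finite G] (t : ℕ) (p : Fin t → ℕ)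
    (hinj : Function.Injective p) (hp : ∀ i, (p i).Prime)
    (hdvd : ∀ i, p i ∣ Nat.card G) :
    ∃ Q : Fin t → Subgroup G, (∀ i, IsPGroup (p i) (Q i)) ∧
      kPi (Set.range p) G ≤ ∏ i, Nat.card (ConjClasses (Q i)) := by
  obtain ⟨Q, hQ, hle⟩ := kPi_finset_le (Finset.univ.image p) (by simpa using hp) G
  refine ⟨fun i => Q (p i), fun i => hQ _ (by simp), ?_⟩
  rw [Finset.prod_image (fun a _ b _ h => hinj h)] at hle
  simpa using hle
end

section
/- Let G be a finite group and let μ ⊆ π be two non-empty sets of primes. Then d(G) ≤ d_π(G) ≤ d_μ(G) ≤ 1. -/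
open scoped Classical Pointwise

theorem piPart_insert_aux (μ : Set ℕ) (p n : ℕ) (hp : p ∉ μ) :
    piPart (insert p μ) n = piPart μ n * p ^ (n.factorization p) := by
  have h : (p ^ (n.factorization p)) =
      n.factorization.prod fun q k => if q = p then q ^ k else 1 := by
    unfold Finsupp.prod
    rw [Finset.prod_ite_eq']
    split_ifs with h
    · rfl
    · rw [Finsupp.notMem_support_iff.mp h, pow_zero]
  rw [h]
  unfold piPart Finsupp.prod
  rw [← Finset.prod_mul_distrib]
  refine Finset.prod_congr rfl fun q _ => ?_
  by_cases hq : q = p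
  · subst hq; simp [hp]
  · simp [hq]

theorem piPart_pos_aux (μ : Set ℕ) (n : ℕ) : 0 < piPart μ n := by
  unfold piPart Finsupp.prod
  refine Finset.prod_pos fun q hq => ?_
  have : q.Prime := Nat.prime_of_mem_primeFactors (by simpa using hq)
  beta_reduce
  split_ifs
  · exact pow_pos this.pos _
  · exact one_pos

theorem dPi_congr_aux {G : Type*} [Group G] [Finite G] (μ π : Set ℕ)
    (h : ∀ p : ℕ, p.Prime → p ∣ Nat.card G → (p ∈ μ ↔ p ∈ π)) : dPi μ G = dPi π G := by
  have h1 : piPart μ (Nat.card G) = piPart π (Nat.card G) := by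
    unfold piPart Finsupp.prod
    refine Finset.prod_congr rfl fun q hq => ?_
    have hq' : q ∈ (Nat.card G).primeFactors := by simpa using hq
    have := h q (Nat.prime_of_mem_primeFactors hq') (Nat.dvd_of_mem_primeFactors hq')
    simp only [this]
  have h2 : ∀ x : G, IsPiElement μ x ↔ IsPiElement π x := fun x =>
    forall_congr' fun q => forall_congr' fun hq => forall_congr' fun hd =>
      h q hq (hd.trans (orderOf_dvd_natCard x))
  unfold dPi kPi
  simp only [h1, h2]

/-- Decomposition of an element into a `p'`-part and a `p`-part. -/
theorem decomp_aux {G : Type*} [Group G] [Finite G] (μ : Set ℕ) (p : ℕ) (hp : p.Prime)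
    (x : G) (hx : IsPiElement (insert p μ) x) :
    ∃ y z : G, x = y * z ∧ Commute y z ∧ IsPiElement μ y ∧ ∃ a : ℕ, z ^ p ^ a = 1 := by
  obtain ⟨a, m, hm, hn⟩ := Nat.exists_eq_pow_mul_and_not_dvd (orderOf_pos x).ne' p hp.ne_one
  have hc : Nat.Coprime (p ^ a) m := Nat.Coprime.pow_left _ ((Nat.Prime.coprime_iff_not_dvd hp).2 hm)
  have hb := Nat.gcd_eq_gcd_ab (p ^ a) m
  rw [hc] at hb
  set u := Nat.gcdA (p ^ a) m
  set v := Nat.gcdB (p ^ a) m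
  have hone : x ^ ((p ^ a * m : ℕ)) = 1 := by rw [← hn]; exact pow_orderOf_eq_one x
  have hone' : x ^ ((p ^ a * m : ℕ) : ℤ) = 1 := by rw [zpow_natCast]; exact hone
  refine ⟨x ^ (((p ^ a : ℕ) : ℤ) * u), x ^ ((m : ℤ) * v), ?_, ?_, ?_, a, ?_⟩
  · rw [← zpow_add, ← hb]; simp
  · exact (Commute.refl x).zpow_zpow _ _
  · intro q hq hd
    have h1 : orderOf (x ^ (((p ^ a : ℕ) : ℤ) * u)) ∣ m := by
      apply orderOf_dvd_of_pow_eq_one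
      rw [← zpow_natCast, ← zpow_mul,
        show ((p ^ a : ℕ) : ℤ) * u * (m : ℤ) = ((p ^ a * m : ℕ) : ℤ) * u by push_cast; ring,
        zpow_mul, hone', one_zpow]
    have hqm := hd.trans h1
    rcases hx q hq (hn ▸ hqm.mul_left _) with h | h
    · exact absurd (h ▸ hqm) hm
    · exact h
  · rw [← zpow_natCast, ← zpow_mul,
      show (m : ℤ) * v * ((p ^ a : ℕ) : ℤ) = ((p ^ a * m : ℕ) : ℤ) * v by push_cast; ring,
      zpow_mul, hone', one_zpow]

/-- Every `p`-element of a subgroup `H` is `H`-conjugate into a fixed small set. -/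
theorem sylow_aux {G : Type*} [Group G] [Finite G] (p : ℕ) (hp : p.Prime) (H : Subgroup G) :
    ∃ T : Set G, T.ncard ≤ p ^ (Nat.card G).factorization p ∧
      ∀ z ∈ H, ∀ a : ℕ, z ^ p ^ a = 1 → ∃ g ∈ H, g * z * g⁻¹ ∈ T := by
  haveI : Fact p.Prime := ⟨hp⟩
  obtain ⟨P⟩ : Nonempty (Sylow p H) := inferInstance
  refine ⟨(fun h : H => (h : G)) '' (P : Set H), ?_, ?_⟩
  · refine (Set.ncard_image_le (Set.toFinite _)).trans ?_
    have h1 : (P : Set H).ncard = Nat.card P := rfl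
    rw [h1, P.card_eq_multiplicity]
    refine Nat.pow_le_pow_right hp.pos ?_
    exact (Nat.factorization_le_iff_dvd Nat.card_pos.ne' Nat.card_pos.ne').2
      (Subgroup.card_subgroup_dvd_card H) p
  · intro z hz a ha
    have hz' : IsPGroup p (Subgroup.zpowers (⟨z, hz⟩ : H)) := by
      have h1 : orderOf (⟨z, hz⟩ : H) ∣ p ^ a :=
        orderOf_dvd_of_pow_eq_one (Subtype.ext (by simpa using ha))
      obtain ⟨k, _, hk⟩ := (Nat.dvd_prime_pow hp).1 h1
      exact IsPGroup.of_card (n := k) (by rw [Nat.card_zpowers, hk])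
    obtain ⟨Q, hQ⟩ := hz'.exists_le_sylow
    obtain ⟨g, hg⟩ := MulAction.exists_smul_eq H Q P
    refine ⟨g, g.2, g * ⟨z, hz⟩ * g⁻¹, ?_, rfl⟩
    rw [← hg]
    have : (⟨z, hz⟩ : H) ∈ Q := hQ (Subgroup.mem_zpowers _)
    show _ ∈ (g • Q : Sylow p H)
    rw [Sylow.smul_def]
    exact ⟨_, this, rfl⟩

theorem kPi_insert_aux {G : Type*} [Group G] [Finite G] (μ : Set ℕ) (p : ℕ) (hp : p.Prime) :
    kPi (insert p μ) G ≤ kPi μ G * p ^ (Nat.card G).factorization p := by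
  choose T hT hT' using fun H : Subgroup G => sylow_aux p hp H
  let S : Set (ConjClasses G) := {c | ∃ x : G, ConjClasses.mk x = c ∧ IsPiElement μ x}
  haveI : Fintype (ConjClasses G) := Fintype.ofFinite _
  let r : ConjClasses G → G := Quotient.out
  have hr : ∀ c, ConjClasses.mk (r c) = c := fun c => Quotient.out_eq c
  let F : ConjClasses G → Finset (ConjClasses G) := fun c =>
    ((fun z => ConjClasses.mk (r c * z)) '' (T (Subgroup.centralizer {r c}))).toFinset
  have key : {c : ConjClasses G | ∃ x : G, ConjClasses.mk x = c ∧ IsPiElement (insert p μ) x} ⊆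
      ((S.toFinset.biUnion F : Finset (ConjClasses G)) : Set (ConjClasses G)) := by
    rintro c ⟨x, rfl, hx⟩
    obtain ⟨y, z, rfl, hyz, hy, a, ha⟩ := decomp_aux μ p hp x hx
    obtain ⟨g, hg⟩ := isConj_iff.1 (ConjClasses.mk_eq_mk_iff_isConj.1 (hr (ConjClasses.mk y)).symm)
    obtain ⟨h, hh, hhz⟩ := hT' (Subgroup.centralizer {r (ConjClasses.mk y)}) (g * z * g⁻¹)
      (by
        rw [Subgroup.mem_centralizer_singleton_iff, ← hg]
        have := hyz.eq
        simp only [mul_assoc, inv_mul_cancel_left]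
        rw [← mul_assoc y, this, mul_assoc]) a (by rw [conj_pow, ha]; simp)
    simp only [Finset.coe_biUnion, Set.mem_iUnion]
    refine ⟨ConjClasses.mk y, by simpa [S] using ⟨y, rfl, hy⟩, ?_⟩
    simp only [F, Set.coe_toFinset]
    refine ⟨_, hhz, ?_⟩
    refine ConjClasses.mk_eq_mk_iff_isConj.2 (IsConj.symm (isConj_iff.2 ⟨h * g, ?_⟩))
    rw [Subgroup.mem_centralizer_singleton_iff] at hh
    have e : h * r (ConjClasses.mk y) * h⁻¹ = r (ConjClasses.mk y) := by
      rw [hh]; simp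
    conv_rhs => rw [← e, ← hg]
    group
  unfold kPi
  calc _ ≤ Set.ncard ((S.toFinset.biUnion F : Finset (ConjClasses G)) : Set (ConjClasses G)) :=
        Set.ncard_le_ncard key (Set.toFinite _)
    _ = (S.toFinset.biUnion F).card := Set.ncard_coe_finset _
    _ ≤ S.toFinset.card * p ^ (Nat.card G).factorization p := by
        refine Finset.card_biUnion_le_card_mul _ _ _ fun c _ => ?_
        rw [← Set.ncard_eq_toFinset_card']
        exact (Set.ncard_image_le (Set.toFinite _)).trans (hT _)
    _ = _ := by
        rw [← Set.ncard_eq_toFinset_card']; rfl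

theorem dPi_insert_aux {G : Type*} [Group G] [Finite G] (μ : Set ℕ) (p : ℕ) (hp : p.Prime) :
    dPi (insert p μ) G ≤ dPi μ G := by
  by_cases h : p ∈ μ
  · rw [Set.insert_eq_of_mem h]
  unfold dPi
  rw [piPart_insert_aux _ _ _ h, div_le_div_iff₀]
  · have := Nat.mul_le_mul_right (piPart μ (Nat.card G)) (kPi_insert_aux (G := G) μ p hp)
    have h2 : ((kPi (insert p μ) G * piPart μ (Nat.card G) : ℕ) : ℚ) ≤
      ((kPi μ G * p ^ (Nat.card G).factorization p * piPart μ (Nat.card G) : ℕ) : ℚ) :=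
      Nat.cast_le.2 this
    push_cast at h2 ⊢
    linarith
  · exact_mod_cast Nat.mul_pos (piPart_pos_aux _ _) (pow_pos hp.pos _)
  · exact_mod_cast piPart_pos_aux _ _

theorem dPi_union_aux {G : Type*} [Group G] [Finite G] (μ : Set ℕ) (s : Finset ℕ)
    (hs : ∀ p ∈ s, p.Prime) : dPi (μ ∪ s) G ≤ dPi μ G := by
  induction s using Finset.induction_on with
  | empty => simp
  | insert p s _ ih =>
    rw [Finset.coe_insert, Set.union_insert]
    exact (dPi_insert_aux _ p (hs p (by simp))).trans (ih fun q hq => hs q (by simp [hq]))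

theorem dPi_mono_aux {G : Type*} [Group G] [Finite G] (μ π : Set ℕ) (h : μ ⊆ π) :
    dPi π G ≤ dPi μ G := by
  let s := (Nat.card G).primeFactors.filter (· ∈ π)
  have h1 : dPi π G = dPi (μ ∪ s) G := by
    refine dPi_congr_aux _ _ fun p hp hd => ?_
    have := @h p
    have h0 : Nat.card G ≠ 0 := Nat.card_pos.ne'
    simp only [s, Set.mem_union, Finset.mem_coe, Finset.mem_filter, Nat.mem_primeFactors]
    tauto
  rw [h1]
  refine dPi_union_aux _ _ fun p hp => ?_
  exact Nat.prime_of_mem_primeFactors (Finset.mem_filter.1 hp).1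

theorem dPi_univ_aux {G : Type*} [Group G] [Finite G] :
    dPi Set.univ G = (Nat.card (ConjClasses G) : ℚ) / (Nat.card G : ℚ) := by
  have h1 : piPart Set.univ (Nat.card G) = Nat.card G := by
    simp only [piPart, Set.mem_univ, if_true]
    exact Nat.prod_factorization_pow_eq_self Nat.card_pos.ne'
  have h2 : {c : ConjClasses G | ∃ x : G, ConjClasses.mk x = c ∧ IsPiElement Set.univ x}
      = Set.univ := by
    ext c
    obtain ⟨x, rfl⟩ := ConjClasses.mk_surjective c
    simp only [Set.mem_univ, iff_true]
    exact ⟨x, rfl, fun _ _ _ => trivial⟩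
  unfold dPi kPi
  rw [h1, h2, Nat.card_congr (Equiv.Set.univ _)]

theorem dPi_empty_aux {G : Type*} [Group G] [Finite G] : dPi ∅ G ≤ 1 := by
  have h1 : piPart ∅ (Nat.card G) = 1 := by simp [piPart]
  have h2 : kPi ∅ G ≤ 1 := by
    have : {c : ConjClasses G | ∃ x : G, ConjClasses.mk x = c ∧ IsPiElement ∅ x} ⊆
        {ConjClasses.mk 1} := by
      rintro c ⟨x, rfl, hx⟩
      have : orderOf x = 1 := by
        by_contra h
        obtain ⟨q, hq, hd⟩ := Nat.exists_prime_and_dvd h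
        exact hx q hq hd
      rw [orderOf_eq_one_iff.1 this]; rfl
    have h3 := Set.ncard_le_ncard this (Set.toFinite _)
    rwa [Set.ncard_singleton] at h3
  unfold dPi
  rw [h1]
  simpa using h2

/-- For non-empty sets of primes `μ ⊆ π`, `d(G) ≤ d_π(G) ≤ d_μ(G) ≤ 1`. -/
theorem d_le_dPi_le_dMu_le_one
    {G : Type*} [Group G] [Finite G] (μ π : Set ℕ)
    (hπ : ∀ p ∈ π, Nat.Prime p) (hμne : μ.Nonempty) (hμπ : μ ⊆ π) :
    (Nat.card (ConjClasses G) : ℚ) / (Nat.card G : ℚ) ≤ dPi π G ∧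
      dPi π G ≤ dPi μ G ∧ dPi μ G ≤ 1 := by
  rw [← dPi_univ_aux]
  exact ⟨dPi_mono_aux _ _ (Set.subset_univ _), dPi_mono_aux _ _ hμπ,
    (dPi_mono_aux _ _ (Set.empty_subset _)).trans dPi_empty_aux⟩
end

section
/- Let G be a finite group, let μ be a set of primes, let p be a prime not in μ, and let π be the disjoint union μ ∪ {p}. Then there exists a subgroup N of G such that k_π(G) ≤ k_μ(G) · k_p(N). -/
open scoped Classical Pointwise

/-- Decomposition of a `π`-element into its commuting `μ`-part and `p`-part. -/
lemma piElement_decomp {G : Type*} [Group G] [Finite G] (μ : Set ℕ) (p : ℕ)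
    (hp : p.Prime) (g : G) (hg : IsPiElement (μ ∪ {p}) g) :
    ∃ x y : G, Commute x y ∧ x * y = g ∧ IsPiElement μ x ∧ IsPiElement {p} y := by
  have hn : orderOf g ≠ 0 := (orderOf_pos g).ne'
  set n := orderOf g with hndef
  obtain ⟨v, m, hpm, hnm⟩ := Nat.exists_eq_pow_mul_and_not_dvd hn p hp.ne_one
  have hcop : Nat.Coprime (p ^ v) m :=
    Nat.Coprime.pow_left v ((Nat.Prime.coprime_iff_not_dvd hp).2 hpm)
  have hbez : (1 : ℤ) = (p ^ v : ℕ) * Nat.gcdA (p ^ v) m + m * Nat.gcdB (p ^ v) m := by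
    have := Nat.gcd_eq_gcd_ab (p ^ v) m
    rw [hcop] at this
    exact_mod_cast this
  have hgn : ∀ k : ℤ, g ^ ((n : ℤ) * k) = 1 := by
    intro k
    rw [zpow_mul, zpow_natCast, pow_orderOf_eq_one, one_zpow]
  refine ⟨g ^ (((p ^ v : ℕ) : ℤ) * Nat.gcdA (p ^ v) m), g ^ ((m : ℤ) * Nat.gcdB (p ^ v) m),
    (Commute.refl g).zpow_zpow _ _, ?_, ?_, ?_⟩
  · rw [← zpow_add, ← hbez, zpow_one]
  · intro q hq hqd
    have h1 : orderOf (g ^ (((p ^ v : ℕ) : ℤ) * Nat.gcdA (p ^ v) m)) ∣ m := by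
      apply orderOf_dvd_of_pow_eq_one
      rw [← zpow_natCast, ← zpow_mul, ← hgn (Nat.gcdA (p ^ v) m), hnm]
      congr 1
      push_cast
      ring
    have h2 : q ∣ m := hqd.trans h1
    rcases hg q hq (by rw [← hndef, hnm]; exact h2.mul_left _) with h | h
    · exact h
    · rw [Set.mem_singleton_iff] at h
      exact absurd (h ▸ h2) hpm
  · intro q hq hqd
    have h1 : orderOf (g ^ ((m : ℤ) * Nat.gcdB (p ^ v) m)) ∣ p ^ v := by
      apply orderOf_dvd_of_pow_eq_one
      rw [← zpow_natCast, ← zpow_mul, ← hgn (Nat.gcdB (p ^ v) m), hnm]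
      congr 1
      push_cast
      ring
    exact (Nat.prime_dvd_prime_iff_eq hq hp).1 (hq.dvd_of_dvd_pow (hqd.trans h1))

/-- The group-theoretic identity behind the conjugation step. -/
lemma conj_mul_aux {G : Type*} [Group G] {a b h k x y : G} (hh : h * x * h⁻¹ = a)
    (hk : k * (h * y * h⁻¹) * k⁻¹ = b) (hc : k * a = a * k) :
    k * h * (x * y) * (k * h)⁻¹ = a * b := by
  calc k * h * (x * y) * (k * h)⁻¹ = k * (h * x * h⁻¹) * (h * y * h⁻¹) * k⁻¹ := by group
    _ = a * k * (h * y * h⁻¹) * k⁻¹ := by rw [hh, hc]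
    _ = a * (k * (h * y * h⁻¹) * k⁻¹) := by group
    _ = a * b := by rw [hk]

/-- If `π` is the disjoint union of `μ` and `{p}`, then
`k_π(G) ≤ k_μ(G) · k_p(N)` for some subgroup `N` of `G`. -/
theorem kPi_le_kMu_mul_kP
    {G : Type*} [Group G] [Finite G] (μ : Set ℕ) (p : ℕ) (π : Set ℕ)
    (hμ : ∀ q ∈ μ, Nat.Prime q) (hp : p.Prime) (hpμ : p ∉ μ)
    (hπ : π = μ ∪ {p}) :
    ∃ N : Subgroup G, kPi π G ≤ kPi μ G * kPi {p} N := by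
  subst hπ
  obtain ⟨N, hN⟩ := Finite.exists_max (fun N : Subgroup G => kPi {p} N)
  refine ⟨N, ?_⟩
  haveI : ∀ H : Subgroup G, Finite (ConjClasses H) := fun H => Quotient.finite _
  haveI : Finite (ConjClasses G) := Quotient.finite _
  let M := {c : ConjClasses G | ∃ x : G, ConjClasses.mk x = c ∧ IsPiElement μ x}
  let C : ConjClasses G → Subgroup G := fun c => Subgroup.centralizer {Quotient.out c}
  let P : ∀ H : Subgroup G, Set (ConjClasses H) := fun H =>
    {c : ConjClasses H | ∃ x : H, ConjClasses.mk x = c ∧ IsPiElement {p} x}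
  let F : (Σ c : M, P (C c.1)) → ConjClasses G := fun s =>
    ConjClasses.mk (Quotient.out s.1.1 * ((Quotient.out s.2.1 : C s.1.1) : G))
  have hsub : {c : ConjClasses G | ∃ x : G, ConjClasses.mk x = c ∧ IsPiElement (μ ∪ {p}) x}
      ⊆ Set.range F := by
    rintro _ ⟨g, rfl, hg⟩
    obtain ⟨x, y, hxy, rfl, hx, hy⟩ := piElement_decomp μ p hp g hg
    have hout : ConjClasses.mk (Quotient.out (ConjClasses.mk x)) = ConjClasses.mk x :=
      Quotient.out_eq _
    obtain ⟨h, hh⟩ := isConj_iff.1 (ConjClasses.mk_eq_mk_iff_isConj.1 hout.symm)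
    have hmem : h * y * h⁻¹ ∈ C (ConjClasses.mk x) := by
      rw [Subgroup.mem_centralizer_singleton_iff, ← hh]
      have := hxy.eq
      calc _ = h * (y * x) * h⁻¹ := by group
        _ = h * (x * y) * h⁻¹ := by rw [this]
        _ = _ := by group
    let z : C (ConjClasses.mk x) := ⟨h * y * h⁻¹, hmem⟩
    have hz : IsPiElement {p} z := by
      intro q hq hqd
      apply hy q hq
      have h1 : orderOf z = orderOf y := by
        rw [← Subgroup.orderOf_coe]
        exact MulEquiv.orderOf_eq (MulAut.conj h) y
      rwa [h1] at hqd
    have hout2 : ConjClasses.mk (Quotient.out (ConjClasses.mk z)) = ConjClasses.mk z :=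
      Quotient.out_eq _
    obtain ⟨k, hk⟩ := isConj_iff.1 (ConjClasses.mk_eq_mk_iff_isConj.1 hout2.symm)
    refine ⟨⟨⟨ConjClasses.mk x, x, rfl, hx⟩, ⟨ConjClasses.mk z, z, rfl, hz⟩⟩, ?_⟩
    refine ConjClasses.mk_eq_mk_iff_isConj.2 (IsConj.symm (isConj_iff.2 ⟨k * h, ?_⟩))
    have hk' : (k : G) * (h * y * h⁻¹) * (k : G)⁻¹
        = ((Quotient.out (ConjClasses.mk z) : C (ConjClasses.mk x)) : G) := by
      rw [← hk]; rfl
    have hkc : (k : G) * Quotient.out (ConjClasses.mk x)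
        = Quotient.out (ConjClasses.mk x) * (k : G) :=
      Subgroup.mem_centralizer_singleton_iff.1 k.2
    exact conj_mul_aux hh hk' hkc
  haveI := Fintype.ofFinite M
  calc kPi (μ ∪ {p}) G ≤ Nat.card (Set.range F) := Nat.card_mono (Set.toFinite _) hsub
    _ ≤ Nat.card (Σ c : M, P (C c.1)) := Finite.card_range_le F
    _ = ∑ c : M, Nat.card (P (C c.1)) := Nat.card_sigma
    _ ≤ ∑ _c : M, kPi {p} N := Finset.sum_le_sum fun c _ => hN (C c.1)
    _ = kPi μ G * kPi {p} N := by
      rw [Finset.sum_const, smul_eq_mul, Finset.card_univ, ← Nat.card_eq_fintype_card]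
      rfl
end

section
/- Let G be a finite group, let μ be a set of primes, let p be a prime not in μ, and let π be the disjoint union μ ∪ {p}. Let x_1, ..., x_k be a complete set of representatives of the conjugacy classes of μ-elements of G (so k = k_μ(G)). Then k_π(G) = Σ_{i=1}^{k} k_p(C_G(x_i)), where C_G(x_i) is the centralizer of x_i in G. -/
open scoped Classical Pointwise

theorem aux_exists_exp {G : Type*} [Group G] [Finite G] (p : ℕ) (hp : p.Prime) :
    ∃ N e m : ℕ, (∀ g : G, (g ^ N) ^ m = 1) ∧ ¬ p ∣ m ∧
      (∀ g : G, g ^ (N * p ^ e) = g ^ (p ^ e)) ∧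
      (∀ a : G, ¬ p ∣ orderOf a → a ^ N = a) ∧
      (∀ b : G, IsPiElement {p} b → b ^ N = 1) := by
  obtain ⟨e, m, hm, hc⟩ := Nat.exists_eq_pow_mul_and_not_dvd
    (Nat.card_pos (α := G)).ne' p hp.ne_one
  have hcop : Nat.Coprime (p ^ e) m := Nat.Coprime.pow_left e ((Nat.Prime.coprime_iff_not_dvd hp).2 hm)
  obtain ⟨N, h0, h1⟩ := Nat.chineseRemainder hcop 0 1
  have hpN : p ^ e ∣ N := (Nat.modEq_zero_iff_dvd).1 h0
  refine ⟨N, e, m, ?_, hm, ?_, ?_, ?_⟩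
  · intro g
    rw [← pow_mul, ← orderOf_dvd_iff_pow_eq_one]
    refine (orderOf_dvd_natCard g).trans ?_
    rw [hc]
    exact Nat.mul_dvd_mul hpN dvd_rfl
  · intro g
    rw [pow_eq_pow_iff_modEq]
    have h : N * p ^ e ≡ 1 * p ^ e [MOD m * p ^ e] := h1.mul_right' _
    rw [one_mul] at h
    refine h.of_dvd ?_
    rw [mul_comm, ← hc]
    exact orderOf_dvd_natCard g
  · intro a ha
    conv_rhs => rw [← pow_one a]
    rw [pow_eq_pow_iff_modEq]
    refine h1.of_dvd ?_
    have h := orderOf_dvd_natCard a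
    rw [hc] at h
    exact Nat.Coprime.dvd_of_dvd_mul_left
      (Nat.Coprime.pow_right e ((Nat.Prime.coprime_iff_not_dvd hp).2 ha).symm) h
  · intro b hb
    rw [← orderOf_dvd_iff_pow_eq_one]
    refine dvd_trans ?_ hpN
    have h := orderOf_dvd_natCard b
    rw [hc] at h
    refine Nat.Coprime.dvd_of_dvd_mul_right ?_ h
    refine Nat.Coprime.symm (Nat.coprime_of_dvd fun q hq hqm hqb => ?_)
    have : q = p := hb q hq hqb
    exact hm (this ▸ hqm)

/-- If `π` is the disjoint union of `μ` and `{p}` and `x 0, …, x (k-1)` is a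
complete set of representatives of the conjugacy classes of `μ`-elements of
`G`, then `k_π(G) = ∑ i, k_p(C_G(x i))`. -/
theorem kPi_eq_sum_kP_centralizer
    {G : Type*} [Group G] [Finite G] (μ : Set ℕ) (p : ℕ) (π : Set ℕ)
    (hμ : ∀ q ∈ μ, Nat.Prime q) (hp : p.Prime) (hpμ : p ∉ μ)
    (hπ : π = μ ∪ {p})
    (k : ℕ) (x : Fin k → G) (hk : k = kPi μ G)
    (hx : ∀ i, IsPiElement μ (x i))
    (hrep : ∀ g : G, IsPiElement μ g → ∃! i : Fin k, IsConj (x i) g) :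
    kPi π G = ∑ i : Fin k, kPi {p} (Subgroup.centralizer {x i}) := by
  subst hπ
  obtain ⟨N, e, m, hNm, hpm, hNe, ha, hb⟩ := aux_exists_exp (G := G) p hp
  have hmu : ∀ a : G, IsPiElement μ a → a ^ N = a := fun a h => ha a fun hd => hpμ (h p hp hd)
  have hcomm : ∀ i (y : Subgroup.centralizer {x i}), Commute (x i) (y : G) := fun i y =>
    (Subgroup.mem_centralizer_singleton_iff.1 y.2).symm
  have hsub : ∀ i (y : Subgroup.centralizer {x i}), IsPiElement {p} y → IsPiElement {p} (y : G) := by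
    intro i y h
    unfold IsPiElement
    rw [Subgroup.orderOf_coe]
    exact h
  have hpow : ∀ i (y : Subgroup.centralizer {x i}), IsPiElement {p} y →
      (x i * (y : G)) ^ N = x i := by
    intro i y h
    rw [(hcomm i y).mul_pow, hmu _ (hx i), hb _ (hsub i y h), mul_one]
  have hmk : ∀ i (y : Subgroup.centralizer {x i}), IsPiElement {p} y →
      IsPiElement (μ ∪ {p}) (x i * (y : G)) := by
    intro i y h q hq hd
    have := hd.trans (hcomm i y).orderOf_mul_dvd_mul_orderOf
    rcases hq.dvd_mul.1 this with h1 | h1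
    · exact Or.inl (hx i q hq h1)
    · exact Or.inr (hsub i y h q hq h1)
  have key : Nat.card (Σ i : Fin k, {c : ConjClasses (Subgroup.centralizer {x i}) |
      ∃ y, ConjClasses.mk y = c ∧ IsPiElement {p} y}) = kPi (μ ∪ {p}) G := by
    unfold kPi
    refine Nat.card_eq_of_bijective (fun s =>
      ⟨ConjClasses.mk (x s.1 * ((s.2.2.choose : Subgroup.centralizer {x s.1}) : G)),
        ⟨_, rfl, hmk _ _ s.2.2.choose_spec.2⟩⟩) ⟨?_, ?_⟩
    · rintro ⟨i, c, hc⟩ ⟨j, d, hd⟩ h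
      simp only [Subtype.mk.injEq] at h
      obtain ⟨hy1, hy2⟩ := hc.choose_spec
      obtain ⟨hz1, hz2⟩ := hd.choose_spec
      generalize hc.choose = y at *
      generalize hd.choose = z at *
      obtain ⟨g, hg⟩ := isConj_iff.1 (ConjClasses.mk_eq_mk_iff_isConj.1 h)
      have hg2 : g * x i * g⁻¹ = x j := by
        rw [← hpow i y hy2, ← hpow j z hz2, ← hg, conj_pow]
      have hij : i = j := (hrep (x j) (hx j)).unique (isConj_iff.2 ⟨g, hg2⟩) (IsConj.refl _)
      subst hij
      have hgc : g ∈ Subgroup.centralizer {x i} := by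
        rw [Subgroup.mem_centralizer_singleton_iff]
        exact mul_inv_eq_iff_eq_mul.1 hg2
      have hcd : c = d := by
        rw [← hy1, ← hz1, ConjClasses.mk_eq_mk_iff_isConj, isConj_iff]
        refine ⟨⟨g, hgc⟩, Subtype.ext ?_⟩
        change g * (y : G) * g⁻¹ = z
        have h3 : g * (x i * (y : G)) * g⁻¹ = (g * x i * g⁻¹) * (g * y * g⁻¹) := by group
        rw [h3, hg2] at hg
        exact mul_left_cancel hg
      subst hcd
      rfl
    · rintro ⟨_, g, rfl, hg⟩
      have hmug : IsPiElement μ (g ^ N) := by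
        intro q hq hd
        rcases hg q hq (hd.trans (orderOf_pow_dvd N)) with h | h
        · exact h
        · have h' : q = p := h
          subst h'
          exact absurd (hd.trans (orderOf_dvd_of_pow_eq_one (hNm g))) hpm
      obtain ⟨i, hi, -⟩ := hrep _ hmug
      obtain ⟨c, hc⟩ := isConj_iff.1 hi
      have hxi : x i = c⁻¹ * g ^ N * c := by rw [← hc]; group
      -- the p-part
      have hcg : Commute g (g ^ N)⁻¹ := ((Commute.refl g).pow_right N).inv_right
      have hpe : (g * (g ^ N)⁻¹) ^ (p ^ e) = 1 := by
        rw [hcg.mul_pow, inv_pow, ← pow_mul, hNe, mul_inv_cancel]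
      have hyc : c⁻¹ * (g * (g ^ N)⁻¹) * c ∈ Subgroup.centralizer {x i} := by
        rw [Subgroup.mem_centralizer_singleton_iff, hxi]
        have h1 : Commute (g * (g ^ N)⁻¹) (g ^ N) :=
          ((Commute.refl g).pow_right N).mul_left (Commute.refl (g ^ N)).inv_left
        calc _ = c⁻¹ * ((g * (g ^ N)⁻¹) * g ^ N) * c := by group
          _ = c⁻¹ * (g ^ N * (g * (g ^ N)⁻¹)) * c := by rw [h1.eq]
          _ = _ := by group
      have hyp : IsPiElement {p} (⟨_, hyc⟩ : Subgroup.centralizer {x i}) := by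
        intro q hq hd
        rw [← Subgroup.orderOf_coe] at hd
        have h1 : (c⁻¹ * (g * (g ^ N)⁻¹) * c) ^ (p ^ e) = 1 := by
          have h2 := conj_pow (i := p ^ e) (a := c⁻¹) (b := g * (g ^ N)⁻¹)
          rw [inv_inv] at h2
          rw [h2, hpe]; group
        have h2 := hd.trans (orderOf_dvd_of_pow_eq_one h1)
        exact (Nat.prime_dvd_prime_iff_eq hq hp).1 (hq.dvd_of_dvd_pow h2)
      have hex : ∃ y, ConjClasses.mk y = ConjClasses.mk (⟨_, hyc⟩ : Subgroup.centralizer {x i}) ∧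
        IsPiElement {p} y := ⟨_, rfl, hyp⟩
      refine ⟨⟨i, ConjClasses.mk ⟨_, hyc⟩, hex⟩, Subtype.ext ?_⟩
      change ConjClasses.mk (x i * (hex.choose : G)) = ConjClasses.mk g
      obtain ⟨d, hd⟩ := isConj_iff.1 (ConjClasses.mk_eq_mk_iff_isConj.1 hex.choose_spec.1)
      have hd' : (d : G) * hex.choose * (d : G)⁻¹ = c⁻¹ * (g * (g ^ N)⁻¹) * c :=
        congrArg Subtype.val hd
      rw [ConjClasses.mk_eq_mk_iff_isConj, isConj_iff]
      refine ⟨c * d, ?_⟩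
      have hdx : (d : G) * x i * (d : G)⁻¹ = x i := by
        rw [← (hcomm i d).eq, mul_inv_cancel_right]
      calc _ = c * (((d : G) * x i * (d : G)⁻¹) * ((d : G) * hex.choose * (d : G)⁻¹)) * c⁻¹ := by
            group
        _ = g ^ N * (g * (g ^ N)⁻¹) := by rw [hdx, hd', hxi]; group
        _ = g := by rw [hcg.eq, mul_inv_cancel_left]
  rw [← key, Nat.card_sigma]
  rfl
end

section
/- Let G be a finite group and π a set of primes. If G contains an abelian Hall π-subgroup, then ∏_{p ∈ π, p | |G|} k_p(G) ≤ k_π(G); consequently ∏_{p ∈ π, p | |G|} d_p(G) ≤ d_π(G). -/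
open scoped Classical Pointwise

lemma aux_piPart_eq (π : Set ℕ) (n : ℕ) :
    piPart π n = ∏ p ∈ n.primeFactors.filter (· ∈ π), p ^ n.factorization p := by
  unfold piPart
  rw [Finsupp.prod, Nat.support_factorization, Finset.prod_filter]

lemma aux_piPart_single {p n : ℕ} (hp : p ∈ n.primeFactors) :
    piPart {p} n = p ^ n.factorization p := by
  rw [aux_piPart_eq]
  refine (Finset.prod_congr ?_ fun _ _ => rfl).trans
    (Finset.prod_singleton (fun q => q ^ n.factorization q) p)
  ext q
  simp only [Finset.mem_filter, Set.mem_singleton_iff, Finset.mem_singleton]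
  exact ⟨fun h => h.2, fun h => ⟨h ▸ hp, h⟩⟩

lemma aux_order_pow {G : Type*} [Group G] [Finite G] {p : ℕ} (x : G)
    (hx : IsPiElement {p} x) : ∃ k, orderOf x = p ^ k := by
  refine ⟨_, Nat.eq_prime_pow_of_unique_prime_dvd (orderOf_pos x).ne' (p := p) ?_⟩
  intro q hq hd
  exact hx q hq hd

/-- Every class of `p`-elements meets `H`. -/
lemma aux_meets {G : Type*} [Group G] [Finite G] (π : Set ℕ)
    (H : Subgroup G) (hH : Nat.card H = piPart π (Nat.card G)) {p : ℕ}
    (hp : p ∈ (Nat.card G).primeFactors.filter (· ∈ π)) (x : G) (hx : IsPiElement {p} x) :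
    ∃ h : H, ConjClasses.mk (h : G) = ConjClasses.mk x := by
  have hpp : p.Prime := Nat.prime_of_mem_primeFactors (Finset.mem_filter.1 hp).1
  have : Fact p.Prime := ⟨hpp⟩
  have hd : p ^ (Nat.card G).factorization p ∣ Nat.card H := by
    rw [hH, aux_piPart_eq]
    exact Finset.dvd_prod_of_mem (fun p => p ^ (Nat.card G).factorization p) hp
  obtain ⟨K, hK⟩ := Sylow.exists_subgroup_card_pow_prime p hd
  have hK' : Nat.card (K.map H.subtype) = p ^ (Nat.card G).factorization p := by
    rw [← hK]
    exact Subgroup.card_map_of_injective H.subtype_injective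
  let P : Sylow p G := Sylow.ofCard (K.map H.subtype) hK'
  obtain ⟨k, hk⟩ := aux_order_pow x hx
  have hz : IsPGroup p (Subgroup.zpowers x) :=
    IsPGroup.of_card (n := k) (by rw [Nat.card_zpowers, hk])
  obtain ⟨Q, hQ⟩ := hz.exists_le_sylow
  obtain ⟨g, hg⟩ := MulAction.exists_smul_eq G Q P
  have hxQ : x ∈ (Q : Subgroup G) := hQ (Subgroup.mem_zpowers x)
  have hm : g * x * g⁻¹ ∈ (P : Subgroup G) := by
    rw [← hg, Sylow.coe_subgroup_smul]
    have := Subgroup.smul_mem_pointwise_smul x (MulAut.conj g) (Q : Subgroup G) hxQ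
    simpa using this
  have hmH : g * x * g⁻¹ ∈ H := by
    have : g * x * g⁻¹ ∈ K.map H.subtype := hm
    obtain ⟨y, -, hy⟩ := this
    rw [← hy]
    exact y.2
  refine ⟨⟨_, hmH⟩, ?_⟩
  rw [ConjClasses.mk_eq_mk_iff_isConj, isConj_comm]
  exact isConj_iff.2 ⟨g, rfl⟩

lemma aux_exp {N p : ℕ} (hN : N ≠ 0) (hp : p.Prime) :
    ∃ n : ℕ, n ≡ 1 [MOD p ^ N.factorization p] ∧ n ≡ 0 [MOD N / p ^ N.factorization p] := by
  have hc : Nat.Coprime (p ^ N.factorization p) (N / p ^ N.factorization p) :=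
    (Nat.coprime_ordCompl hp hN).pow_left _
  exact ⟨_, (Nat.chineseRemainder hc 1 0).2⟩

lemma aux_isPi_congr {G : Type*} [Group G] {π : Set ℕ} {x y : G}
    (h : ConjClasses.mk x = ConjClasses.mk y) (hx : IsPiElement π x) : IsPiElement π y := by
  rw [ConjClasses.mk_eq_mk_iff_isConj] at h
  obtain ⟨c, rfl⟩ := isConj_iff.1 h
  intro q hq hd
  have h2 : orderOf (c * x * c⁻¹) = orderOf x := by
    have := MulEquiv.orderOf_eq (MulAut.conj c) x
    simpa using this
  exact hx q hq (h2 ▸ hd)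

lemma aux_first {G : Type*} [Group G] [Finite G] (π : Set ℕ)
    (H : Subgroup G) (hH : Nat.card H = piPart π (Nat.card G))
    (hab : ∀ x y : H, x * y = y * x) :
    (∏ p ∈ (Nat.card G).primeFactors.filter (· ∈ π), kPi {p} G) ≤ kPi π G := by
  let : CommGroup H := { (inferInstance : Group H) with mul_comm := hab }
  set s := (Nat.card G).primeFactors.filter (· ∈ π) with hs
  have hN : Nat.card G ≠ 0 := Nat.card_pos.ne'
  have key : ∀ (p : s) (c : {c : ConjClasses G | ∃ x : G, ConjClasses.mk x = c ∧
      IsPiElement {(p : ℕ)} x}), ∃ h : H, ConjClasses.mk (h : G) = c.1 ∧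
      IsPiElement {(p : ℕ)} (h : G) := by
    rintro ⟨p, hp⟩ ⟨c, x, rfl, hx⟩
    obtain ⟨h, hh⟩ := aux_meets π H hH hp x hx
    exact ⟨h, hh, aux_isPi_congr hh.symm hx⟩
  choose r hr1 hr2 using key
  rw [← Finset.prod_coe_sort]
  unfold kPi
  rw [← Nat.card_pi]
  let F : (∀ p : s, {c : ConjClasses G | ∃ x : G, ConjClasses.mk x = c ∧
      IsPiElement {(p : ℕ)} x}) → H := fun f => ∏ p, r p (f p)
  have hF : ∀ f, IsPiElement π (F f : G) := by
    intro f q hq hd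
    rw [Subgroup.orderOf_coe] at hd
    have h1 : q ∣ Nat.card H := hd.trans (orderOf_dvd_natCard _)
    rw [hH, aux_piPart_eq] at h1
    obtain ⟨p, hp, hqp⟩ := (Prime.dvd_finsetProd_iff hq.prime _).1 h1
    have hp' := Finset.mem_filter.1 hp
    have := (Nat.prime_dvd_prime_iff_eq hq (Nat.prime_of_mem_primeFactors hp'.1)).1
      (hq.dvd_of_dvd_pow hqp)
    rw [this]
    exact hp'.2
  have hrec : ∀ (p : s), ∃ n : ℕ, ∀ f, F f ^ n = r p (f p) := by
    intro p
    have hpp : (p : ℕ).Prime := Nat.prime_of_mem_primeFactors (Finset.mem_filter.1 p.2).1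
    obtain ⟨n, hn1, hn0⟩ := aux_exp hN hpp
    refine ⟨n, fun f => ?_⟩
    have hord : ∀ q : s, ∃ k, orderOf (r q (f q)) = (q : ℕ) ^ k := by
      intro q
      obtain ⟨k, hk⟩ := aux_order_pow _ (hr2 q (f q))
      exact ⟨k, by rw [← hk, Subgroup.orderOf_coe]⟩
    have hdvd : ∀ q : s, orderOf (r q (f q)) ∣ Nat.card G := fun q =>
      (orderOf_dvd_natCard _).trans (Subgroup.card_subgroup_dvd_card H)
    change (∏ q, r q (f q)) ^ n = _
    rw [← Finset.prod_pow, Finset.prod_eq_single p]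
    · obtain ⟨k, hk⟩ := hord p
      have h1 : orderOf (r p (f p)) ∣ (p : ℕ) ^ (Nat.card G).factorization p := by
        have := hdvd p
        rw [hk] at this ⊢
        exact pow_dvd_pow _ ((hpp.pow_dvd_iff_le_factorization hN).1 this)
      have h2 := pow_eq_pow_iff_modEq.2 (hn1.of_dvd h1)
      rw [h2, pow_one]
    · intro q _ hqp
      have hqq : (q : ℕ).Prime := Nat.prime_of_mem_primeFactors (Finset.mem_filter.1 q.2).1
      obtain ⟨k, hk⟩ := hord q
      have hc : Nat.Coprime (orderOf (r q (f q))) ((p : ℕ) ^ (Nat.card G).factorization p) := by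
        rw [hk]
        apply Nat.Coprime.pow
        exact (Nat.coprime_primes hqq hpp).2 (fun h => hqp (Subtype.ext h))
      have h1 : orderOf (r q (f q)) ∣ Nat.card G / (p : ℕ) ^ (Nat.card G).factorization p := by
        apply hc.dvd_of_dvd_mul_left
        rw [Nat.ordProj_mul_ordCompl_eq_self]
        exact hdvd q
      have h2 := pow_eq_pow_iff_modEq.2 (hn0.of_dvd h1)
      rw [h2, pow_zero]
    · intro h
      exact absurd (Finset.mem_univ _) h
  refine Nat.card_le_card_of_injective
    (fun f => ⟨ConjClasses.mk (F f : G), (F f : G), rfl, hF f⟩) ?_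
  intro f f' hff
  have h1 : ConjClasses.mk (F f : G) = ConjClasses.mk (F f' : G) := congrArg Subtype.val hff
  rw [ConjClasses.mk_eq_mk_iff_isConj] at h1
  funext p
  obtain ⟨n, hn⟩ := hrec p
  apply Subtype.ext
  rw [← hr1, ← hr1, ← hn, ← hn, ConjClasses.mk_eq_mk_iff_isConj]
  obtain ⟨c, hc⟩ := isConj_iff.1 h1
  refine isConj_iff.2 ⟨c, ?_⟩
  rw [Subgroup.coe_pow, Subgroup.coe_pow, ← hc, conj_pow]

theorem prod_kP_le_kPi_of_abelian_hall
    {G : Type*} [Group G] [Finite G] (π : Set ℕ)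
    (hπ : ∀ p ∈ π, Nat.Prime p)
    (H : Subgroup G) (hH : Nat.card H = piPart π (Nat.card G))
    (hab : ∀ x y : H, x * y = y * x) :
    (∏ p ∈ (Nat.card G).primeFactors.filter (· ∈ π), kPi {p} G) ≤ kPi π G ∧
    (∏ p ∈ (Nat.card G).primeFactors.filter (· ∈ π), dPi {p} G) ≤ dPi π G := by
  have h1 := aux_first π H hH hab
  refine ⟨h1, ?_⟩
  unfold dPi
  rw [Finset.prod_div_distrib]
  have h2 : (∏ p ∈ (Nat.card G).primeFactors.filter (· ∈ π),
      (piPart {p} (Nat.card G) : ℚ)) = (piPart π (Nat.card G) : ℚ) := by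
    rw [aux_piPart_eq π, Nat.cast_prod]
    refine Finset.prod_congr rfl fun p hp => ?_
    rw [aux_piPart_single (Finset.mem_filter.1 hp).1]
  rw [h2]
  gcongr
  exact_mod_cast h1
end
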